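/- arXiv:1612.07314 — 3 statements merged into one kernel-verified Lean document; each statement's English description precedes it below -/
import Mathlib

section
/- If n > N, then there is no continuous map f : S^n → S^N that is odd, i.e. satisfies f(-x) = -f(x) for all x ∈ S^n. -/
open MvPolynomial

/-- If `E` is locally finite, then `1 + s E` is bijective for all but countably many `s`. -/
theorem Module.End.exists_countable_bijective_id_add_smul {K M : Type*} [Field K] [AddCommGroup M]
    [Module K M] (F : ℕ → Submodule K M) [∀ N, FiniteDimensional K (F N)]
    (hF : ∀ x, ∃ N, x ∈ F N) (E : Module.End K M) (hE : ∀ N, ∀ x ∈ F N, E x ∈ F N) :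
    ∃ C : Set K, C.Countable ∧ ∀ s ∉ C, Function.Bijective fun x => x + s • E x := by
  let EN : ∀ N, Module.End K (F N) := fun N => E.restrict (hE N)
  refine ⟨⋃ N, (fun z => -z⁻¹) '' spectrum K (EN N), Set.countable_iUnion fun N =>
    ((Module.End.finite_spectrum (EN N)).image _).countable, fun s hs => ?_⟩
  have hb : ∀ N, Function.Bijective ((1 : Module.End K (F N)) + s • EN N) := by
    intro N
    rw [← Module.End.isUnit_iff]
    rcases eq_or_ne s 0 with rfl | h0
    · simp
    · have h1 : -s⁻¹ ∉ spectrum K (EN N) := fun h =>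
        hs (Set.mem_iUnion.2 ⟨N, -s⁻¹, h, by simp⟩)
      rw [spectrum.notMem_iff] at h1
      have h2 := h1.smul (Units.mk0 (-s) (neg_ne_zero.2 h0))
      have h3 : (1 : Module.End K (F N)) + s • EN N = Units.mk0 (-s) (neg_ne_zero.2 h0) •
          (algebraMap K (Module.End K (F N)) (-s⁻¹) - EN N) := by
        rw [Units.smul_def, Units.val_mk0, smul_sub, Algebra.algebraMap_eq_smul_one, smul_smul]
        simp [h0]
      rwa [h3]
  constructor
  · intro x y hxy
    obtain ⟨N, hN⟩ := hF (x - y)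
    have h := (hb N).1 (a₁ := ⟨x - y, hN⟩) (a₂ := 0) (by
      ext
      have : x - y + s • (E x - E y) = 0 := by
        rw [smul_sub, sub_add_sub_comm, sub_eq_zero]
        exact hxy
      simpa [EN] using this)
    exact sub_eq_zero.1 (congrArg Subtype.val h)
  · intro y
    obtain ⟨N, hN⟩ := hF y
    obtain ⟨x, hx⟩ := (hb N).2 ⟨y, hN⟩
    exact ⟨x, by simpa [EN] using congrArg Subtype.val hx⟩

/-- Polynomials annihilating an odd-dimensional real representation have a common real zero. -/
theorem MvPolynomial.exists_eval_eq_zero_of_odd_finrank {σ : Type*} (k : ℕ) :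
    ∀ (M : Type*) [AddCommGroup M] [Module ℝ M] [Module (MvPolynomial σ ℝ) M]
      [IsScalarTower ℝ (MvPolynomial σ ℝ) M] [FiniteDimensional ℝ M],
      Module.finrank ℝ M = k → Odd k →
      ∃ a : σ → ℝ, ∀ p : MvPolynomial σ ℝ, (∀ m : M, p • m = 0) → eval a p = 0 := by
  induction k using Nat.strong_induction_on with
  | _ k ih =>
  intro M _ _ _ _ _ hk hodd
  have hnt : Nontrivial M := Module.nontrivial_of_finrank_pos (R := ℝ) (by rw [hk]; exact hodd.pos)
  by_cases hs : IsSimpleModule (MvPolynomial σ ℝ) M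
  · obtain ⟨m, hm⟩ := exists_ne (0 : M)
    have hmax : (Ideal.torsionOf (MvPolynomial σ ℝ) M m).IsMaximal :=
      IsSimpleModule.ker_toSpanSingleton_isMaximal (MvPolynomial σ ℝ) hm
    set I := Ideal.torsionOf (MvPolynomial σ ℝ) M m with hI
    let _ : Field (MvPolynomial σ ℝ ⧸ I) := Ideal.Quotient.field I
    let φ : (MvPolynomial σ ℝ ⧸ I) ≃ₗ[MvPolynomial σ ℝ] M :=
      LinearMap.quotKerEquivOfSurjective (LinearMap.toSpanSingleton (MvPolynomial σ ℝ) M m)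
        (IsSimpleModule.toSpanSingleton_surjective (MvPolynomial σ ℝ) hm)
    let φ' : (MvPolynomial σ ℝ ⧸ I) ≃ₗ[ℝ] M := φ.restrictScalars ℝ
    have hfin : FiniteDimensional ℝ (MvPolynomial σ ℝ ⧸ I) := Module.Finite.equiv φ'.symm
    have hr : Module.finrank ℝ (MvPolynomial σ ℝ ⧸ I) = k := by rw [← hk]; exact φ'.finrank_eq
    rcases Real.nonempty_algEquiv_or (MvPolynomial σ ℝ ⧸ I) with ⟨⟨e⟩⟩ | ⟨⟨e⟩⟩
    · let ψ : MvPolynomial σ ℝ →ₐ[ℝ] ℝ := e.toAlgHom.comp (Ideal.Quotient.mkₐ ℝ I)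
      refine ⟨fun i => ψ (X i), fun p hp => ?_⟩
      have h1 : eval (fun i => ψ (X i)) p = ψ p := by
        rw [← coe_aeval_eq_eval]
        exact (DFunLike.congr_fun (aeval_unique ψ) p).symm
      have h2 : p ∈ I := hp m
      rw [h1]
      simp [ψ, Ideal.Quotient.eq_zero_iff_mem.2 h2]
    · rw [e.toLinearEquiv.finrank_eq, Complex.finrank_real_complex] at hr
      subst hr
      exact absurd hodd (by decide)
  · have : ∃ N : Submodule (MvPolynomial σ ℝ) M, N ≠ ⊥ ∧ N ≠ ⊤ := by
      by_contra! h
      exact hs ((isSimpleModule_iff ..).2 { eq_bot_or_eq_top := fun N => or_iff_not_imp_left.2 (h N) })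
    obtain ⟨N, hbot, htop⟩ := this
    have hsum := (N.restrictScalars ℝ).finrank_quotient_add_finrank
    have hlt : Module.finrank ℝ (N.restrictScalars ℝ) < Module.finrank ℝ M :=
      Submodule.finrank_lt (by simpa using htop)
    have hpos : 0 < Module.finrank ℝ (N.restrictScalars ℝ) :=
      Nat.pos_of_ne_zero fun h => hbot (by
        have := Submodule.finrank_eq_zero.1 h
        simpa using this)
    have hq : Module.finrank ℝ (M ⧸ N) = Module.finrank ℝ (M ⧸ N.restrictScalars ℝ) := rfl
    have hn : Module.finrank ℝ N = Module.finrank ℝ (N.restrictScalars ℝ) := rfl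
    have hfN : FiniteDimensional ℝ N := inferInstanceAs (FiniteDimensional ℝ (N.restrictScalars ℝ))
    have hfQ : FiniteDimensional ℝ (M ⧸ N) :=
      inferInstanceAs (FiniteDimensional ℝ (M ⧸ N.restrictScalars ℝ))
    rw [hk] at hsum hlt
    rw [← hsum, Nat.odd_add] at hodd
    by_cases hoN : Odd (Module.finrank ℝ (N.restrictScalars ℝ))
    · obtain ⟨a, ha⟩ := ih _ hlt N hn hoN
      exact ⟨a, fun p hp => ha p fun m => Subtype.ext (hp m)⟩
    · obtain ⟨a, ha⟩ := ih _ (by omega) (M ⧸ N) hq (hodd.2 (Nat.not_odd_iff_even.1 hoN))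
      refine ⟨a, fun p hp => ha p fun m => ?_⟩
      obtain ⟨m, rfl⟩ := N.mkQ_surjective m
      rw [← map_smul, hp, map_zero]

section Staircase

variable {σ K : Type*} [Field K]

theorem MvPolynomial.restrictSupport_le_comap {M : Type*} [AddCommGroup M] [Module K M]
    {T : Set (σ →₀ ℕ)} {W : Submodule K M} {L : MvPolynomial σ K →ₗ[K] M}
    (h : ∀ m ∈ T, L (monomial m 1) ∈ W) : restrictSupport K T ≤ W.comap L := by
  rw [restrictSupport_eq_span, Submodule.span_le]
  rintro _ ⟨m, hm, rfl⟩
  exact h m hm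

theorem MvPolynomial.mem_of_monomial_mem {M : Type*} [AddCommGroup M] [Module K M]
    {W : Submodule K M} {L : MvPolynomial σ K →ₗ[K] M}
    (h : ∀ m, L (monomial m 1) ∈ W) (p : MvPolynomial σ K) : L p ∈ W :=
  restrictSupport_le_comap (T := Set.univ) (fun m _ => h m) (by simp)

theorem MvPolynomial.monomial_mul_X_pow (d : ℕ) (m : σ →₀ ℕ) (i : σ) :
    (monomial m 1 : MvPolynomial σ K) * X i ^ d = monomial (m + Finsupp.single i d) 1 := by
  rw [X_pow_eq_monomial, monomial_mul, one_mul]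

variable [Fintype σ]

/-- The linear map `q ↦ ∑ i, q i * g i`. -/
noncomputable def MvPolynomial.sumMul (g : σ → MvPolynomial σ K) :
    (σ → MvPolynomial σ K) →ₗ[K] MvPolynomial σ K :=
  (Fintype.linearCombination (MvPolynomial σ K) g).restrictScalars K

theorem MvPolynomial.sumMul_apply (g q : σ → MvPolynomial σ K) :
    sumMul g q = ∑ i, q i * g i := rfl

theorem MvPolynomial.sumMul_single [DecidableEq σ] (g : σ → MvPolynomial σ K) (i : σ) (p : MvPolynomial σ K) :
    sumMul g (Pi.single i p) = p * g i := by
  rw [sumMul_apply, Finset.sum_eq_single i] <;> simp +contextual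

theorem MvPolynomial.sumMul_mul (g q : σ → MvPolynomial σ K) (p : MvPolynomial σ K) :
    sumMul g (fun j => p * q j) = p * sumMul g q := by
  simp only [sumMul_apply, Finset.mul_sum, mul_assoc]

theorem MvPolynomial.sumMul_add_smul (g f q : σ → MvPolynomial σ K) (s : K) :
    sumMul (fun i => g i + C s * f i) q = sumMul g q + s • sumMul f q := by
  simp only [sumMul_apply, mul_add, Finset.sum_add_distrib, Finset.smul_sum, smul_eq_C_mul]
  congr 1
  exact Finset.sum_congr rfl fun i _ => by ring

variable [LinearOrder σ] (d : ℕ) {S : Set σ}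

theorem Finsupp.forall_lt_or_exists_add_single (hS : IsLowerSet S) (m : σ →₀ ℕ) :
    (∀ i ∈ S, m i < d) ∨
      ∃ j ∈ S, ∃ m' : σ →₀ ℕ, (∀ k < j, m' k < d) ∧ m = m' + Finsupp.single j d := by
  rw [or_iff_not_imp_left]
  intro h
  push Not at h
  obtain ⟨j, ⟨hj, hjd⟩, hmin⟩ := WellFounded.has_min (wellFounded_lt (α := σ))
    {i | i ∈ S ∧ d ≤ m i} h
  refine ⟨j, hj, m - Finsupp.single j d, fun k hk => ?_, ?_⟩
  · rw [Finsupp.tsub_apply, Finsupp.single_eq_of_ne hk.ne, tsub_zero]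
    by_contra! hkd
    exact hmin k ⟨hS hk.le hj, hkd⟩ hk
  · exact (tsub_add_cancel_of_le (by simpa using hjd)).symm

open Classical in
/-- The quotients of the division by the powers `X i ^ d`, `i ∈ S`: every monomial is divided by
the power of the first variable that allows it. -/
noncomputable def MvPolynomial.powQuot (S : Set σ) :
    MvPolynomial σ K →ₗ[K] (σ → MvPolynomial σ K) :=
  (basisMonomials σ K).constr K fun m =>
    if h : ∃ j ∈ S, ∃ m' : σ →₀ ℕ, (∀ k < j, m' k < d) ∧ m = m' + Finsupp.single j d then
      Pi.single h.choose (monomial h.choose_spec.2.choose 1) else 0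

open Classical in
theorem MvPolynomial.powQuot_monomial_of_lt {m : σ →₀ ℕ} (hm : ∀ i ∈ S, m i < d) :
    powQuot (K := K) d S (monomial m 1) = 0 := by
  have := (basisMonomials σ K).constr_basis K (fun m =>
    if h : ∃ j ∈ S, ∃ m' : σ →₀ ℕ, (∀ k < j, m' k < d) ∧ m = m' + Finsupp.single j d then
      (Pi.single h.choose (monomial h.choose_spec.2.choose 1) : σ → MvPolynomial σ K) else 0) m
  rw [coe_basisMonomials] at this
  rw [powQuot]
  convert this using 1
  rw [dif_neg]
  rintro ⟨j, hj, m', -, rfl⟩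
  simpa using hm j hj

open Classical in
theorem MvPolynomial.powQuot_monomial_add {m : σ →₀ ℕ} {j : σ} (hj : j ∈ S)
    (hm : ∀ k < j, m k < d) :
    powQuot d S (monomial (m + Finsupp.single j d) 1) =
      (Pi.single j (monomial m 1) : σ → MvPolynomial σ K) := by
  have := (basisMonomials σ K).constr_basis K (fun m =>
    if h : ∃ j ∈ S, ∃ m' : σ →₀ ℕ, (∀ k < j, m' k < d) ∧ m = m' + Finsupp.single j d then
      (Pi.single h.choose (monomial h.choose_spec.2.choose 1) : σ → MvPolynomial σ K) else 0)
      (m + Finsupp.single j d)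
  rw [coe_basisMonomials] at this
  rw [powQuot]
  convert this using 1
  have h : ∃ j' ∈ S, ∃ m' : σ →₀ ℕ, (∀ k < j', m' k < d) ∧
      m + Finsupp.single j d = m' + Finsupp.single j' d := ⟨j, hj, m, hm, rfl⟩
  rw [dif_pos h]
  obtain ⟨h1, h2⟩ := h.choose_spec.2.choose_spec
  have hjj : j = h.choose := by
    rcases lt_trichotomy j h.choose with hlt | heq | hgt
    · have := h1 j hlt
      have h3 := DFunLike.congr_fun h2 j
      rw [Finsupp.add_apply, Finsupp.add_apply, Finsupp.single_eq_same,
        Finsupp.single_eq_of_ne hlt.ne] at h3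
      omega
    · exact heq
    · have := hm _ hgt
      have h3 := DFunLike.congr_fun h2 h.choose
      rw [Finsupp.add_apply, Finsupp.add_apply, Finsupp.single_eq_same,
        Finsupp.single_eq_of_ne hgt.ne] at h3
      omega
  have h3 : m = h.choose_spec.2.choose := add_right_cancel (h2.trans
    (congrArg (fun l => h.choose_spec.2.choose + Finsupp.single l d) hjj.symm))
  rw [← h3, ← hjj]

theorem MvPolynomial.sub_sumMul_powQuot_mem (hS : IsLowerSet S) (p : MvPolynomial σ K) :
    p - sumMul (fun i => X i ^ d) (powQuot d S p) ∈
      restrictSupport K {m : σ →₀ ℕ | ∀ i ∈ S, m i < d} := by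
  refine mem_of_monomial_mem (L := LinearMap.id - sumMul (fun i => X i ^ d) ∘ₗ powQuot d S)
    (fun m => ?_) p
  simp only [LinearMap.sub_apply, LinearMap.id_apply, LinearMap.comp_apply]
  rcases Finsupp.forall_lt_or_exists_add_single d hS m with h | ⟨j, hj, m', hm', rfl⟩
  · rw [powQuot_monomial_of_lt d h, map_zero, sub_zero]
    simpa using h
  · rw [powQuot_monomial_add d hj hm', sumMul_single, monomial_mul_X_pow, sub_self]
    exact zero_mem _

theorem MvPolynomial.powQuot_eq_zero {p : MvPolynomial σ K}
    (hp : p ∈ restrictSupport K {m : σ →₀ ℕ | ∀ i ∈ S, m i < d}) : powQuot d S p = 0 :=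
  restrictSupport_le_comap (W := ⊥) (L := powQuot d S)
    (fun _ hm => (Submodule.mem_bot K).2 (powQuot_monomial_of_lt d hm)) hp

theorem MvPolynomial.powQuot_mul_X_pow {p : MvPolynomial σ K} {j : σ} (hj : j ∈ S)
    (hp : p ∈ restrictSupport K {m : σ →₀ ℕ | ∀ k < j, m k < d}) :
    powQuot d S (p * X j ^ d) = Pi.single j p := by
  let L : MvPolynomial σ K →ₗ[K] (σ → MvPolynomial σ K) :=
    powQuot d S ∘ₗ LinearMap.mulRight K (X j ^ d) -
      LinearMap.single K (fun _ : σ => MvPolynomial σ K) j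
  have hL : ∀ p, L p = powQuot d S (p * X j ^ d) - Pi.single j p := fun _ => rfl
  have h : L p ∈ (⊥ : Submodule K (σ → MvPolynomial σ K)) :=
    restrictSupport_le_comap (W := ⊥) (L := L) (fun m hm => by
      rw [hL, monomial_mul_X_pow, powQuot_monomial_add d hj hm, sub_self]
      exact zero_mem _) hp
  rwa [Submodule.mem_bot, hL, sub_eq_zero] at h

theorem MvPolynomial.powQuot_sumMul {q : σ → MvPolynomial σ K}
    (hq : ∀ i, q i ∈ restrictSupport K {m : σ →₀ ℕ | ∀ k < i, m k < d}) :
    powQuot d Set.univ (sumMul (fun i => X i ^ d) q) = q := by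
  rw [sumMul_apply, map_sum]
  simp only [powQuot_mul_X_pow d (Set.mem_univ _) (hq _)]
  exact Finset.univ_sum_single q

theorem MvPolynomial.mul_powQuot_mem_restrictTotalDegree (hS : IsLowerSet S)
    {f : MvPolynomial σ K} (hf : f.totalDegree ≤ d) {N : ℕ} {p : MvPolynomial σ K}
    (hp : p ∈ restrictTotalDegree σ K N) (j : σ) :
    f * powQuot d S p j ∈ restrictTotalDegree σ K N := by
  have key : ∀ m : σ →₀ ℕ, m.degree ≤ N →
      f * powQuot d S (monomial m 1) j ∈ restrictTotalDegree σ K N := by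
    intro m hm
    rcases Finsupp.forall_lt_or_exists_add_single d hS m with h | ⟨i, hi, m', hm', rfl⟩
    · rw [powQuot_monomial_of_lt d h, Pi.zero_apply, mul_zero]
      exact zero_mem _
    · rw [powQuot_monomial_add d hi hm']
      rcases eq_or_ne j i with rfl | hne
      · rw [Pi.single_eq_same, mem_restrictTotalDegree]
        refine (totalDegree_mul _ _).trans
          ((add_le_add hf (totalDegree_monomial_le _ _)).trans ?_)
        rw [map_add, Finsupp.degree_single] at hm
        change d + m'.degree ≤ N
        omega
      · rw [Pi.single_eq_of_ne hne, mul_zero]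
        exact zero_mem _
  have h : restrictTotalDegree σ K N ≤ (restrictTotalDegree σ K N).comap
      (LinearMap.mulLeft K f ∘ₗ LinearMap.proj j ∘ₗ powQuot d S) :=
    restrictSupport_le_comap fun m hm => by
      simpa only [LinearMap.comp_apply, LinearMap.proj_apply, LinearMap.mulLeft_apply] using
        key m hm
  simpa only [Submodule.mem_comap, LinearMap.comp_apply, LinearMap.proj_apply,
    LinearMap.mulLeft_apply] using h hp

theorem MvPolynomial.mul_powQuot_mem_restrictSupport (i j : σ) (p : MvPolynomial σ K) :
    X i ^ d * powQuot d (Set.Iio i) p j ∈ restrictSupport K {m : σ →₀ ℕ | ∀ k < j, m k < d} := by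
  refine mem_of_monomial_mem (L := LinearMap.mulLeft K (X i ^ d) ∘ₗ LinearMap.proj j ∘ₗ
    powQuot d (Set.Iio i)) (fun m => ?_) p
  simp only [LinearMap.comp_apply, LinearMap.proj_apply, LinearMap.mulLeft_apply]
  rcases Finsupp.forall_lt_or_exists_add_single d (isLowerSet_Iio i) m with
    h | ⟨l, hl, m', hm', rfl⟩
  · rw [powQuot_monomial_of_lt d h, Pi.zero_apply, mul_zero]
    exact zero_mem _
  · rw [powQuot_monomial_add d hl hm']
    rcases eq_or_ne j l with rfl | hne
    · rw [Pi.single_eq_same, mul_comm, monomial_mul_X_pow, monomial_mem_restrictSupport]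
      refine Or.inl fun k hk => ?_
      rw [Finsupp.add_apply, Finsupp.single_eq_of_ne (hk.trans hl).ne]
      exact hm' k hk
    · rw [Pi.single_eq_of_ne hne, mul_zero]
      exact zero_mem _

theorem MvPolynomial.finrank_restrictSupport_forall_lt :
    Module.finrank K (restrictSupport K {m : σ →₀ ℕ | ∀ i ∈ Set.univ, m i < d}) =
      d ^ Fintype.card σ := by
  rw [Module.finrank_eq_nat_card_basis (basisRestrictSupport K _)]
  let e : {m : σ →₀ ℕ | ∀ i ∈ Set.univ, m i < d} ≃ (σ → Fin d) :=
    { toFun := fun m i => ⟨m.1 i, m.2 i trivial⟩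
      invFun := fun g => ⟨Finsupp.equivFunOnFinite.symm fun i => (g i : ℕ), fun i _ => (g i).2⟩
      left_inv := fun m => by ext; rfl
      right_inv := fun g => by ext; rfl }
  rw [Nat.card_congr e]
  simp

end Staircase

section Deformation

variable {σ K : Type*} [Field K] [Fintype σ] [LinearOrder σ]

/-- For all but countably many `s`, every combination of the `X i ^ d + s * f i` is one in which
the `i`-th coefficient has degree less than `d` in every variable before the `i`-th. -/
theorem MvPolynomial.exists_countable_sumMul_reduced (d : ℕ) (f : σ → MvPolynomial σ K)
    (hf : ∀ i, (f i).totalDegree ≤ d) :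
    ∃ C : Set K, C.Countable ∧ ∀ s ∉ C, ∀ q : σ → MvPolynomial σ K,
      ∃ q' : σ → MvPolynomial σ K,
        (∀ i, q' i ∈ restrictSupport K {m : σ →₀ ℕ | ∀ k < i, m k < d}) ∧
        sumMul (fun i => X i ^ d + MvPolynomial.C s * f i) q =
          sumMul (fun i => X i ^ d + MvPolynomial.C s * f i) q' := by
  let F : ℕ → Submodule K (σ → MvPolynomial σ K) := fun N =>
    Submodule.pi Set.univ fun _ => restrictTotalDegree σ K N
  have hfin : ∀ N, FiniteDimensional K (F N) := fun N => by
    let φ : F N →ₗ[K] (σ → restrictTotalDegree σ K N) :=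
      { toFun := fun x i => ⟨x.1 i, x.2 i trivial⟩
        map_add' := fun _ _ => rfl
        map_smul' := fun _ _ => rfl }
    refine FiniteDimensional.of_injective φ fun x y hxy => ?_
    ext1
    funext i
    exact congrArg Subtype.val (congrFun hxy i)
  let E : Module.End K (σ → MvPolynomial σ K) :=
    LinearMap.lsum K (fun _ : σ => MvPolynomial σ K) K fun i =>
      LinearMap.single K (fun _ : σ => MvPolynomial σ K) i ∘ₗ sumMul f ∘ₗ
        powQuot d (Set.Iio i) -
      (LinearMap.pi fun j => LinearMap.mulLeft K (f i) ∘ₗ LinearMap.proj j ∘ₗ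
        powQuot d (Set.Iio i))
  have hE : ∀ q, E q = ∑ i, (Pi.single i (sumMul f (powQuot d (Set.Iio i) (q i))) -
      fun j => f i * powQuot d (Set.Iio i) (q i) j) := fun q => by
    simp only [E, LinearMap.lsum_apply, LinearMap.sum_apply]
    rfl
  have hEF : ∀ N, ∀ q ∈ F N, E q ∈ F N := by
    intro N q hq
    rw [hE]
    refine Submodule.sum_mem _ fun i _ => Submodule.sub_mem _ ?_ ?_
    · intro l _
      rcases eq_or_ne l i with rfl | hne
      · rw [Pi.single_eq_same, sumMul_apply]
        refine Submodule.sum_mem _ fun j _ => ?_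
        rw [mul_comm]
        exact mul_powQuot_mem_restrictTotalDegree d (isLowerSet_Iio l) (hf j) (hq l trivial) j
      · rw [Pi.single_eq_of_ne hne]
        exact zero_mem _
    · exact fun j _ =>
        mul_powQuot_mem_restrictTotalDegree d (isLowerSet_Iio i) (hf i) (hq i trivial) j
  obtain ⟨C, hC, hbij⟩ := Module.End.exists_countable_bijective_id_add_smul F (fun q =>
    ⟨Finset.univ.sup fun i => (q i).totalDegree, fun i _ => (mem_restrictTotalDegree _ _ _).2
      (Finset.le_sup (f := fun i => (q i).totalDegree) (Finset.mem_univ i))⟩) E hEF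
  refine ⟨C, hC, fun s hs q => ?_⟩
  obtain ⟨q, rfl⟩ := (hbij s hs).2 q
  refine ⟨∑ i, (Pi.single i (q i - sumMul (fun i => X i ^ d) (powQuot d (Set.Iio i) (q i))) +
    fun j => X i ^ d * powQuot d (Set.Iio i) (q i) j), fun l => ?_, ?_⟩
  · rw [Finset.sum_apply]
    refine Submodule.sum_mem _ fun i _ => Submodule.add_mem _ ?_ ?_
    · rcases eq_or_ne l i with rfl | hne
      · rw [Pi.single_eq_same]
        exact sub_sumMul_powQuot_mem d (isLowerSet_Iio l) (q l)
      · rw [Pi.single_eq_of_ne hne]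
        exact zero_mem _
    · exact mul_powQuot_mem_restrictSupport d i l (q i)
  · have hq : q = ∑ i, Pi.single i (q i) := (Finset.univ_sum_single q).symm
    rw [map_add, map_smul, hE]
    conv_lhs => enter [1]; rw [hq]
    simp only [map_sum, map_sub, map_add, Finset.smul_sum, ← Finset.sum_add_distrib,
      sumMul_single, sumMul_mul]
    refine Finset.sum_congr rfl fun i _ => ?_
    rw [sumMul_add_smul]
    simp only [smul_eq_C_mul]
    ring

/-- For all but countably many `s`, the ideal of the `X i ^ d + s * f i` has colength
`d ^ card σ`. -/
theorem MvPolynomial.exists_countable_finrank_quotient (d : ℕ) (f : σ → MvPolynomial σ K)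
    (hf : ∀ i, (f i).totalDegree ≤ d) :
    ∃ C : Set K, C.Countable ∧ ∀ s ∉ C,
      Module.finrank K (MvPolynomial σ K ⧸
        Ideal.span (Set.range fun i => X i ^ d + MvPolynomial.C s * f i)) =
        d ^ Fintype.card σ := by
  obtain ⟨C₁, hC₁, h₁⟩ := exists_countable_sumMul_reduced d f hf
  obtain ⟨C₂, hC₂, h₂⟩ := Module.End.exists_countable_bijective_id_add_smul
    (fun N => restrictTotalDegree σ K N)
    (fun p => ⟨p.totalDegree, (mem_restrictTotalDegree _ _ _).2 le_rfl⟩)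
    (sumMul f ∘ₗ powQuot d Set.univ) (fun N p hp => by
      rw [LinearMap.comp_apply, sumMul_apply]
      refine Submodule.sum_mem _ fun j _ => ?_
      rw [mul_comm]
      exact mul_powQuot_mem_restrictTotalDegree d isLowerSet_univ (hf j) hp j)
  refine ⟨C₁ ∪ C₂, hC₁.union hC₂, fun s hs => ?_⟩
  rw [Set.mem_union, not_or] at hs
  set I := Ideal.span (Set.range fun i => X i ^ d + MvPolynomial.C s * f i) with hI
  have hmem : ∀ q, sumMul (fun i => X i ^ d + MvPolynomial.C s * f i) q ∈ I := fun q =>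
    Ideal.sum_mem _ fun i _ => Ideal.mul_mem_left _ _ (Ideal.subset_span ⟨i, rfl⟩)
  have hcompl : IsCompl (I.restrictScalars K)
      (restrictSupport K {m : σ →₀ ℕ | ∀ i ∈ Set.univ, m i < d}) := by
    constructor
    · rw [Submodule.disjoint_def]
      intro r hrI hrV
      obtain ⟨q, hq⟩ := Ideal.mem_span_range_iff_exists_fun.1 (show r ∈ I from hrI)
      obtain ⟨q', hq', hqq⟩ := h₁ s hs.1 q
      have hr : r = sumMul (fun i => X i ^ d + MvPolynomial.C s * f i) q' := by
        rw [← hqq, ← hq, sumMul_apply]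
      have hQ : powQuot d Set.univ (r - sumMul (fun i => X i ^ d) q') = -q' := by
        rw [map_sub, powQuot_eq_zero d hrV, powQuot_sumMul d hq', zero_sub]
      have h0 : r - sumMul (fun i => X i ^ d) q' = 0 := (h₂ s hs.2).1 (by
        simp only [LinearMap.comp_apply, hQ]
        rw [hr, sumMul_add_smul]
        simp)
      rw [h0, map_zero, eq_comm, neg_eq_zero] at hQ
      rw [hr, hQ, map_zero]
    · rw [codisjoint_iff, eq_top_iff]
      intro p _
      obtain ⟨p, rfl⟩ := (h₂ s hs.2).2 p
      refine Submodule.mem_sup.2 ⟨_, hmem (powQuot d Set.univ p), _,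
        sub_sumMul_powQuot_mem d isLowerSet_univ p, ?_⟩
      simp only [sumMul_add_smul, LinearMap.comp_apply]
      abel
  rw [← finrank_restrictSupport_forall_lt (σ := σ) (K := K) d]
  exact (Submodule.quotientEquivOfIsCompl _ _ hcompl).finrank_eq

/-- An odd-degree deformation of the powers `X i ^ d` has a real zero for arbitrarily large
values of the parameter. -/
theorem MvPolynomial.exists_gt_exists_eval_eq_zero {d : ℕ} (hd : Odd d)
    (f : σ → MvPolynomial σ ℝ) (hf : ∀ i, (f i).totalDegree ≤ d) (t : ℝ) :
    ∃ s > t, ∃ y : σ → ℝ, ∀ i, y i ^ d + s * eval y (f i) = 0 := by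
  obtain ⟨C, hC, h⟩ := exists_countable_finrank_quotient d f hf
  obtain ⟨s, hs, hst⟩ := (hC.dense_compl ℝ).exists_mem_open isOpen_Ioi (Set.nonempty_Ioi (a := t))
  have hfr := h s hs
  have hfin : FiniteDimensional ℝ (MvPolynomial σ ℝ ⧸
      Ideal.span (Set.range fun i => X i ^ d + MvPolynomial.C s * f i)) :=
    Module.finite_of_finrank_pos (by rw [hfr]; exact pow_pos hd.pos _)
  obtain ⟨y, hy⟩ := exists_eval_eq_zero_of_odd_finrank (σ := σ) _ (MvPolynomial σ ℝ ⧸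
    Ideal.span (Set.range fun i => X i ^ d + MvPolynomial.C s * f i)) hfr hd.pow
  refine ⟨s, hst, y, fun i => ?_⟩
  have := hy (X i ^ d + MvPolynomial.C s * f i) fun m => by
    obtain ⟨m, rfl⟩ := Ideal.Quotient.mk_surjective m
    rw [← Ideal.Quotient.mk_eq_mk, ← Submodule.Quotient.mk_smul, Submodule.Quotient.mk_eq_zero]
    exact Ideal.mul_mem_right _ _ (Ideal.subset_span ⟨i, rfl⟩)
  simpa using this

end Deformation

theorem MvPolynomial.exists_abs_eval_sub_lt {ι : Type*} [Fintype ι] {S : Set (EuclideanSpace ℝ ι)}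
    [CompactSpace S] {f : S → ℝ} (hf : Continuous f) {ε : ℝ} (hε : 0 < ε) :
    ∃ p : MvPolynomial ι ℝ, ∀ x : S, |eval (fun i => x.1 i) p - f x| < ε := by
  let c : ι → C(S, ℝ) := fun i => ⟨fun x => x.1 i, by fun_prop⟩
  have hsep : (aeval c : MvPolynomial ι ℝ →ₐ[ℝ] C(S, ℝ)).range.SeparatesPoints := by
    intro x y hxy
    obtain ⟨i, hi⟩ : ∃ i, x.1 i ≠ y.1 i := by
      by_contra! h
      exact hxy (Subtype.ext (PiLp.ext h))
    exact ⟨c i, ⟨c i, ⟨X i, aeval_X _ _⟩, rfl⟩, hi⟩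
  obtain ⟨⟨_, p, rfl⟩, hp⟩ :=
    ContinuousMap.exists_mem_subalgebra_near_continuous_of_separatesPoints _ hsep f hf ε hε
  refine ⟨p, fun x => ?_⟩
  have h : aeval c p x = eval (fun i => x.1 i) p := by
    have := DFunLike.congr_fun (comp_aeval c (ContinuousMap.evalAlgHom ℝ ℝ x)) p
    rw [← coe_aeval_eq_eval]
    exact this
  rw [← h]
  exact hp x

theorem MvPolynomial.IsHomogeneous.eval_smul {σ R : Type*} [CommSemiring R]
    {p : MvPolynomial σ R} {d : ℕ} (hp : p.IsHomogeneous d) (r : R) (x : σ → R) :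
    eval (fun i => r * x i) p = r ^ d * eval x p := by
  rw [eval_eq, eval_eq, Finset.mul_sum]
  refine Finset.sum_congr rfl fun m hm => ?_
  have h : ∑ i ∈ m.support, m i = d := by
    rw [← hp.degree_eq_sum_deg_support hm]
  simp only [mul_pow, Finset.prod_mul_distrib, Finset.prod_pow_eq_pow_sum, h]
  ring

theorem MvPolynomial.totalDegree_aeval_le {σ τ R : Type*} [CommSemiring R]
    {g : σ → MvPolynomial τ R} (hg : ∀ i, (g i).totalDegree ≤ 1) (p : MvPolynomial σ R) :
    (aeval g p).totalDegree ≤ p.totalDegree := by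
  rw [aeval_def, eval₂_eq]
  refine (totalDegree_finsetSum _ _).trans (Finset.sup_le fun m hm => ?_)
  refine (totalDegree_mul _ _).trans ?_
  rw [algebraMap_eq, totalDegree_C, zero_add]
  refine (totalDegree_finsetProd _ _).trans (le_trans ?_ (le_totalDegree hm))
  refine Finset.sum_le_sum fun i _ => (totalDegree_pow _ _).trans ?_
  exact mul_le_of_le_one_right (Nat.zero_le _) (hg i)

/-- The odd part of a polynomial agrees on the unit sphere with a homogeneous polynomial. -/
theorem MvPolynomial.exists_isHomogeneous_eval_eq {ι : Type*} [Fintype ι] (p : MvPolynomial ι ℝ)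
    {d : ℕ} (hd : Odd d) (hpd : p.totalDegree ≤ d) :
    ∃ q : MvPolynomial ι ℝ, q.IsHomogeneous d ∧ ∀ x : ι → ℝ, ∑ i, x i ^ 2 = 1 →
      eval x q = (eval x p - eval (fun i => - x i) p) / 2 := by
  refine ⟨∑ j ∈ Finset.range (d + 1) with Odd j,
    homogeneousComponent j p * (∑ i, X i ^ 2) ^ ((d - j) / 2), ?_, fun x hx => ?_⟩
  · refine IsHomogeneous.sum _ _ _ fun j hj => ?_
    rw [Finset.mem_filter, Finset.mem_range] at hj
    have h1 := (homogeneousComponent_isHomogeneous j p).mul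
      ((IsHomogeneous.sum Finset.univ (fun i : ι => (X i ^ 2 : MvPolynomial ι ℝ)) 2
        fun i _ => isHomogeneous_X_pow i 2).pow ((d - j) / 2))
    convert h1 using 1
    obtain ⟨a, ha⟩ := hd
    obtain ⟨b, hb⟩ := hj.2
    omega
  · have hsum : p = ∑ j ∈ Finset.range (d + 1), homogeneousComponent j p := by
      conv_lhs => rw [← sum_homogeneousComponent p]
      refine Finset.sum_subset (Finset.range_mono (by omega)) fun j _ hj => ?_
      exact homogeneousComponent_eq_zero _ _ (by simpa using hj)
    have hneg : ∀ j, eval (fun i => - x i) (homogeneousComponent j p) =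
        (-1) ^ j * eval x (homogeneousComponent j p) := fun j => by
      simpa using (homogeneousComponent_isHomogeneous j p).eval_smul (-1) x
    conv_rhs => rw [hsum]
    simp only [map_sum, map_mul, map_pow, eval_X, hx, one_pow, mul_one, hneg]
    rw [← Finset.sum_sub_distrib, Finset.sum_div, Finset.sum_filter]
    refine Finset.sum_congr rfl fun j _ => ?_
    split_ifs with h
    · rw [h.neg_one_pow]; ring
    · rw [(Nat.not_odd_iff_even.1 h).neg_one_pow]; ring

open Metric in
/-- As many odd continuous functions on the sphere as its dimension are simultaneously small
somewhere. -/
theorem exists_forall_abs_lt_of_odd {n : ℕ}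
    (f : Fin n → sphere (0 : EuclideanSpace ℝ (Fin (n + 1))) 1 → ℝ)
    (hf : ∀ i, Continuous (f i)) (hodd : ∀ i x, f i (-x) = -f i x) {ε : ℝ} (hε : 0 < ε) :
    ∃ x, ∀ i, |f i x| < ε := by
  choose p hp using fun i => exists_abs_eval_sub_lt (hf i) (half_pos hε)
  set d := 2 * (Finset.univ.sup fun i => (p i).totalDegree) + 1 with hd
  have hdodd : Odd d := ⟨_, rfl⟩
  choose q hq hqp using fun i => exists_isHomogeneous_eval_eq (p i) hdodd (by
    have := Finset.le_sup (f := fun i => (p i).totalDegree) (Finset.mem_univ i)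
    omega)
  let g : Fin (n + 1) → MvPolynomial (Fin n) ℝ := Fin.cons 1 X
  have hg : ∀ i, (g i).totalDegree ≤ 1 := by
    intro i
    refine Fin.cases ?_ (fun i => ?_) i
    · simp [g]
    · simp [g]
  obtain ⟨s, hs, y, hy⟩ := exists_gt_exists_eval_eq_zero hdodd (fun i => aeval g (q i))
    (fun i => (totalDegree_aeval_le hg _).trans (hq i).totalDegree_le) (2 / ε)
  have hs0 : 0 < s := (by positivity : 0 < 2 / ε).trans hs
  let w : EuclideanSpace ℝ (Fin (n + 1)) := WithLp.toLp 2 (Fin.cons 1 y)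
  have hw : ∀ i, eval y (aeval g (q i)) = eval (fun i => w i) (q i) := by
    intro i
    have := DFunLike.congr_fun (comp_aeval g (aeval y : MvPolynomial (Fin n) ℝ →ₐ[ℝ] ℝ)) (q i)
    rw [← coe_aeval_eq_eval, ← coe_aeval_eq_eval]
    refine this.trans ?_
    have hgw : (fun i => aeval y (g i)) = fun i => w i := by
      funext i
      refine Fin.cases ?_ (fun i => ?_) i
      · simp [g, w]
      · simp [g, w]
    rw [hgw]
    rfl
  have hw0 : w ≠ 0 := fun h => by
    have := congrArg (fun v : EuclideanSpace ℝ (Fin (n + 1)) => v 0) h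
    simp [w] at this
  have hr : 0 < ‖w‖ := norm_pos_iff.2 hw0
  let u : sphere (0 : EuclideanSpace ℝ (Fin (n + 1))) 1 :=
    ⟨‖w‖⁻¹ • w, by rw [mem_sphere_zero_iff_norm, norm_smul, norm_inv, norm_norm,
      inv_mul_cancel₀ hr.ne']⟩
  have hwu : (fun i => w i) = fun i => ‖w‖ * u.1 i := by
    funext i
    simp only [u, PiLp.smul_apply, smul_eq_mul]
    rw [mul_inv_cancel_left₀ hr.ne']
  have hu1 : ∑ i, u.1 i ^ 2 = 1 := by
    rw [← EuclideanSpace.real_norm_sq_eq, norm_eq_of_mem_sphere, one_pow]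
  refine ⟨u, fun i => ?_⟩
  have hqs : |eval (fun i => u.1 i) (q i)| < ε / 2 := by
    have h1 := hy i
    rw [hw, hwu, (hq i).eval_smul] at h1
    have hyw : |y i| ≤ ‖w‖ := by
      have := PiLp.norm_apply_le w i.succ
      simpa [w] using this
    have h2 : s * |eval (fun i => u.1 i) (q i)| * ‖w‖ ^ d ≤ 1 * ‖w‖ ^ d := by
      have h3 : s * eval (fun i => u.1 i) (q i) * ‖w‖ ^ d = - y i ^ d := by linarith
      have h4 := congrArg abs h3
      rw [abs_mul, abs_mul, abs_of_pos hs0, abs_of_pos (pow_pos hr d), abs_neg, abs_pow] at h4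
      rw [h4, one_mul]
      exact pow_le_pow_left₀ (abs_nonneg _) hyw d
    have h5 := le_of_mul_le_mul_right h2 (pow_pos hr d)
    rw [gt_iff_lt, div_lt_iff₀ hε] at hs
    by_contra! h7
    nlinarith
  have h1 := hp i u
  have h2 := hp i (-u)
  rw [hodd] at h2
  have h3 := hqp i _ hu1
  have h4 : (fun i => (-u : sphere (0 : EuclideanSpace ℝ (Fin (n + 1))) 1).1 i) =
    fun i => - u.1 i := rfl
  rw [h4] at h2
  rw [h3] at hqs
  rw [abs_lt] at *
  constructor <;> linarith [hqs.1, hqs.2, h1.1, h1.2, h2.1, h2.2]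

/-- If `n > N` then there is no continuous odd map `f : S^n → S^N`. -/
theorem no_continuous_odd_map_of_gt (n N : ℕ) (h : n > N) :
    ¬ ∃ f : (Metric.sphere (0 : EuclideanSpace ℝ (Fin (n + 1))) 1) →
        (Metric.sphere (0 : EuclideanSpace ℝ (Fin (N + 1))) 1),
      Continuous f ∧ ∀ x, f (-x) = -f x := by
  rintro ⟨f, hf, hodd⟩
  obtain ⟨x, hx⟩ := exists_forall_abs_lt_of_odd
    (fun (i : Fin n) x => if hi : (i : ℕ) < N + 1 then (f x).1 ⟨i, hi⟩ else 0)
    (fun i => by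
      by_cases hi : (i : ℕ) < N + 1
      · simp only [hi, dite_true]
        fun_prop
      · simp only [hi, dite_false]
        fun_prop)
    (fun i x => by
      by_cases hi : (i : ℕ) < N + 1
      · simp [hi, hodd]
      · simp [hi]) (ε := 1 / (N + 1)) (by positivity)
  have hsum : ∑ i, (f x).1 i ^ 2 = 1 := by
    rw [← EuclideanSpace.real_norm_sq_eq, norm_eq_of_mem_sphere, one_pow]
  have hlt : ∑ i, (f x).1 i ^ 2 < ∑ _i : Fin (N + 1), (1 / (N + 1) : ℝ) := by
    refine Finset.sum_lt_sum_of_nonempty Finset.univ_nonempty fun i _ => ?_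
    have h1 := hx (Fin.castLE h i)
    simp only [Fin.val_castLE, i.2, dite_true] at h1
    have h2 : (1 / (N + 1) : ℝ) ≤ 1 := by
      rw [div_le_one (by positivity)]
      linarith [(Nat.cast_nonneg N : (0 : ℝ) ≤ N)]
    rw [← sq_abs]
    nlinarith [abs_nonneg ((f x).1 i)]
  rw [hsum, Finset.sum_const, Finset.card_univ, Fintype.card_fin, nsmul_eq_mul] at hlt
  push_cast at hlt
  rw [mul_one_div_cancel (by positivity)] at hlt
  exact lt_irrefl _ hlt
end

section
/- Let q ≥ 2 be a natural number and ζ = Complex.exp(2 * π * I / q). If m > N ≥ 1, then there is no continuous map f from the unit sphere of EuclideanSpace ℂ (Fin m) to the unit sphere of EuclideanSpace ℂ (Fin N) satisfying f(ζ • x) = ζ • f(x) for all x. -/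
open Complex

open MeasureTheory Metric Set Filter Topology Polynomial in
/-- If an integrand depends polynomially, with bounded degree, on a parameter `t`, and its integral
is constant for small positive `t`, then the integral is constant. -/
theorem integral_eq_of_polynomial_of_small {α : Type*} [MeasurableSpace α] {μ : Measure α}
    {F : ℝ → α → ℝ} {D : ℕ}
    (hpoly : ∀ x, ∃ p : ℝ[X], p.natDegree ≤ D ∧ ∀ t, F t x = p.eval t)
    (hint : ∀ t, Integrable (F t) μ) {c ε : ℝ} (hε : 0 < ε)
    (hsmall : ∀ t, 0 < t → t < ε → ∫ x, F t x ∂μ = c) (t : ℝ) : ∫ x, F t x ∂μ = c := by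
  set s := Finset.range (D + 1)
  set v : ℕ → ℝ := fun i => ε / (i + 2) with hv
  have hvpos (i : ℕ) : 0 < v i := by positivity
  have hvlt (i : ℕ) : v i < ε := div_lt_self hε (by linarith [Nat.cast_nonneg (α := ℝ) i])
  have hinj : Set.InjOn v s := by
    intro i _ j _ hij
    have h1 : (i : ℝ) + 2 ≠ 0 := by positivity
    have h2 : (j : ℝ) + 2 ≠ 0 := by positivity
    simp only [hv] at hij
    rw [div_eq_div_iff h1 h2] at hij
    have := mul_left_cancel₀ hε.ne' hij
    exact_mod_cast (by linarith : (i : ℝ) = j)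
  have key : ∀ x, F t x = ∑ i ∈ s, F (v i) x * (Lagrange.basis s v i).eval t := by
    intro x
    obtain ⟨p, hp, hF⟩ := hpoly x
    have h1 : p.degree < s.card := by
      rw [Finset.card_range]
      exact lt_of_le_of_lt degree_le_natDegree (by exact_mod_cast Nat.lt_succ_of_le hp)
    have h2 := Lagrange.eq_interpolate hinj h1
    rw [Lagrange.interpolate_apply] at h2
    rw [hF t]
    conv_lhs => rw [h2]
    rw [eval_finsetSum]
    refine Finset.sum_congr rfl fun i _ => ?_
    rw [eval_mul, eval_C, hF]
  simp_rw [key]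
  rw [integral_finsetSum _ fun i _ => (hint _).mul_const _]
  have : ∀ i ∈ s, ∫ x, F (v i) x * (Lagrange.basis s v i).eval t ∂μ
      = c * (Lagrange.basis s v i).eval t := fun i _ => by
    rw [integral_mul_const, hsmall _ (hvpos i) (hvlt i)]
  rw [Finset.sum_congr rfl this, ← Finset.mul_sum, ← eval_finsetSum,
    Lagrange.sum_basis hinj ⟨0, by simp [s]⟩, eval_one, mul_one]

section
variable {E : Type*} [NormedAddCommGroup E] [NormedSpace ℝ E] [FiniteDimensional ℝ E]

open Polynomial in
theorem exists_polynomial_det_id_add_smul (M : E →L[ℝ] E) :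
    ∃ p : ℝ[X], p.natDegree ≤ Module.finrank ℝ E ∧
      ∀ t : ℝ, (ContinuousLinearMap.id ℝ E + t • M).det = p.eval t := by
  let b := Module.finBasis ℝ E
  let B := LinearMap.toMatrix b b (M : E →ₗ[ℝ] E)
  refine ⟨Matrix.det ((X : ℝ[X]) • B.map C + (1 : Matrix _ _ ℝ).map C), ?_, fun t => ?_⟩
  · simpa using Polynomial.natDegree_det_X_add_C_le B 1
  · rw [ContinuousLinearMap.det, ← LinearMap.det_toMatrix b, ← coe_evalRingHom, RingHom.map_det]
    congr 1
    ext i j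
    simp [B, LinearMap.toMatrix_apply, Matrix.one_apply, Finsupp.single_apply, eq_comm,
      apply_ite, add_comm]
    exact mul_comm _ _

open Metric Set in
theorem bijOn_closedBall_id_add_of_lipschitz {h : E → E} {K : NNReal} (hK : K < 1)
    (hL : LipschitzWith K h) {R : ℝ} (h0 : ∀ x, R ≤ ‖x‖ → h x = 0) :
    InjOn (fun x => x + h x) (closedBall 0 R) ∧
      (fun x => x + h x) '' closedBall 0 R = closedBall 0 R := by
  have hinj : Function.Injective (fun x => x + h x) := by
    intro x y hxy
    have h1 : x - y = h y - h x := by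
      have : x + h x = y + h y := hxy
      rw [sub_eq_sub_iff_add_eq_add, this, add_comm]
    have h2 : ‖x - y‖ ≤ K * ‖x - y‖ := by
      have := hL.dist_le_mul y x
      rw [dist_eq_norm, dist_eq_norm, ← h1, norm_sub_rev y x] at this
      exact this
    have hK' : (K : ℝ) < 1 := by exact_mod_cast hK
    have : ‖x - y‖ = 0 := by nlinarith [norm_nonneg (x - y)]
    exact sub_eq_zero.1 (norm_eq_zero.1 this)
  have hsurj : Function.Surjective (fun x => x + h x) := by
    intro y
    have : ContractingWith K (fun x => y - h x) := by
      refine ⟨hK, LipschitzWith.of_dist_le_mul fun a b => ?_⟩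
      rw [dist_sub_left]
      exact hL.dist_le_mul a b
    have hfix : y - h this.fixedPoint = this.fixedPoint := this.fixedPoint_isFixedPt
    exact ⟨this.fixedPoint, by simp [← eq_sub_iff_add_eq, hfix]⟩
  have hout : ∀ x, x ∉ closedBall (0 : E) R → x + h x = x := by
    intro x hx
    rw [mem_closedBall_zero_iff, not_le] at hx
    rw [h0 x hx.le, add_zero]
  refine ⟨hinj.injOn, Subset.antisymm ?_ ?_⟩
  · rintro _ ⟨x, hx, rfl⟩
    by_contra hc
    have := hinj (show (fun x => x + h x) (x + h x) = (fun x => x + h x) x from hout _ hc)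
    simp only at hc
    exact hc (by rwa [show x + h x = x from this])
  · intro y hy
    obtain ⟨x, rfl⟩ := hsurj y
    by_contra hc
    refine hc ⟨x, ?_, rfl⟩
    by_contra hx
    simp only [hout x hx] at hy
    exact hx hy
end

section
variable {E : Type*} [NormedAddCommGroup E] [InnerProductSpace ℝ E] [FiniteDimensional ℝ E]
  [MeasurableSpace E] [BorelSpace E]

open MeasureTheory Metric Set Filter Topology Polynomial in
theorem integral_polynomial_norm_sq_mul_det_fderiv (μ : Measure E) [μ.IsAddHaarMeasure]
    {G : E → E} (hG : ContDiff ℝ 1 G) {R : ℝ} (hGR : ∀ x, R ≤ ‖x‖ → G x = x) (P : ℝ[X]) :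
    ∫ x in closedBall 0 R, P.eval (‖G x‖ ^ 2) * (fderiv ℝ G x).det ∂μ =
      ∫ x in closedBall 0 R, P.eval (‖x‖ ^ 2) ∂μ := by
  set h : E → E := fun x => G x - x with hh
  have hC : ContDiff ℝ 1 h := hG.sub contDiff_id
  have h0 : ∀ x, R ≤ ‖x‖ → h x = 0 := fun x hx => by simp [hh, hGR x hx]
  have hcs : HasCompactSupport h := by
    refine HasCompactSupport.intro (isCompact_closedBall (0 : E) R) fun x hx => h0 x ?_
    rw [mem_closedBall_zero_iff, not_le] at hx
    exact hx.le
  obtain ⟨K, hK⟩ := hC.lipschitzWith_of_hasCompactSupport hcs one_ne_zero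
  have hder (t : ℝ) (x : E) : HasFDerivAt (fun x => x + t • h x)
      (ContinuousLinearMap.id ℝ E + t • fderiv ℝ h x) x :=
    (hasFDerivAt_id x).add ((hC.differentiable one_ne_zero x).hasFDerivAt.const_smul t)
  set F : ℝ → E → ℝ := fun t x => P.eval (‖x + t • h x‖ ^ 2) *
    (ContinuousLinearMap.id ℝ E + t • fderiv ℝ h x).det with hF
  have hFc (t : ℝ) : Continuous (F t) := by
    have := hC.continuous
    have h2 := hC.continuous_fderiv one_ne_zero
    refine (P.continuous.comp (by fun_prop)).mul (ContinuousLinearMap.continuous_det.comp ?_)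
    fun_prop
  -- near the identity the determinant is positive
  obtain ⟨r, hr, hdet⟩ : ∃ r > 0, ∀ M : E →L[ℝ] E, ‖M‖ < r →
      0 < (ContinuousLinearMap.id ℝ E + M).det := by
    have hc : Continuous fun M : E →L[ℝ] E => (ContinuousLinearMap.id ℝ E + M).det :=
      ContinuousLinearMap.continuous_det.comp (by fun_prop)
    have : {M : E →L[ℝ] E | 0 < (ContinuousLinearMap.id ℝ E + M).det} ∈ 𝓝 0 :=
      (isOpen_lt continuous_const hc).mem_nhds (by simp [ContinuousLinearMap.det])
    obtain ⟨r, hr, hsub⟩ := Metric.mem_nhds_iff.1 this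
    exact ⟨r, hr, fun M hM => hsub (by simpa using hM)⟩
  have hmain := integral_eq_of_polynomial_of_small (μ := μ.restrict (closedBall 0 R)) (F := F)
    (D := P.natDegree * 2 + Module.finrank ℝ E) (c := ∫ x in closedBall 0 R, P.eval (‖x‖ ^ 2) ∂μ)
    (ε := min 1 r / (K + 1)) ?_ ?_ (by positivity) ?_ 1
  · rw [← hmain]
    refine integral_congr_ae (ae_of_all _ fun x => ?_)
    have h1 : x + (1 : ℝ) • h x = G x := by simp [hh]
    have h2 : ContinuousLinearMap.id ℝ E + (1 : ℝ) • fderiv ℝ h x = fderiv ℝ G x := by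
      rw [← (hder 1 x).fderiv]
      congr 1
      ext x; simp [hh]
    simp only [hF, h1, h2]
  · intro x
    obtain ⟨p, hp, hpe⟩ := exists_polynomial_det_id_add_smul (fderiv ℝ h x)
    set Q : ℝ[X] := C (‖h x‖ ^ 2) * X ^ 2 + C (2 * inner ℝ x (h x)) * X + C (‖x‖ ^ 2)
    refine ⟨P.comp Q * p, ?_, fun t => ?_⟩
    · refine natDegree_mul_le.trans (add_le_add ?_ hp)
      rw [natDegree_comp]
      exact Nat.mul_le_mul_left _ natDegree_quadratic_le
    · simp only [hF, eval_mul, eval_comp, hpe]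
      congr 2
      rw [norm_add_sq_real, inner_smul_right, norm_smul, mul_pow, Real.norm_eq_abs, sq_abs]
      simp [Q]
      ring
  · exact fun t => ((hFc t).continuousOn.integrableOn_compact (isCompact_closedBall _ _))
  · intro t ht0 ht
    have hK1 : (0 : ℝ) < K + 1 := by positivity
    rw [lt_div_iff₀ hK1] at ht
    have ht1 : t * K < 1 := by nlinarith [min_le_left 1 r]
    have ht2 : t * K < r := by nlinarith [min_le_right 1 r]
    have hL : LipschitzWith (‖t‖₊ * K) (fun x => t • h x) := (lipschitzWith_smul t).comp hK
    obtain ⟨hinj, himg⟩ := bijOn_closedBall_id_add_of_lipschitz (R := R) (h := fun x => t • h x)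
      (K := ‖t‖₊ * K) (by
        rw [← NNReal.coe_lt_coe]; simpa [abs_of_pos ht0] using ht1) hL
      (fun x hx => by simp [h0 x hx])
    have hcv := integral_image_eq_integral_abs_det_fderiv_smul μ
      (isClosed_closedBall (x := (0 : E)) (ε := R)).measurableSet
      (fun x _ => (hder t x).hasFDerivWithinAt) hinj (fun y => P.eval (‖y‖ ^ 2))
    rw [himg] at hcv
    rw [hcv]
    refine integral_congr_ae (ae_of_all _ fun x => ?_)
    have : 0 < (ContinuousLinearMap.id ℝ E + t • fderiv ℝ h x).det := by
      refine hdet _ ?_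
      rw [norm_smul, Real.norm_eq_abs, abs_of_pos ht0]
      refine lt_of_le_of_lt ?_ ht2
      exact mul_le_mul_of_nonneg_left (norm_fderiv_le_of_lipschitz ℝ hK) ht0.le
    simp only [hF, smul_eq_mul, abs_of_pos this, mul_comm]

open MeasureTheory Metric Set Filter Topology Polynomial in
/-- The degree formula for a `C¹` self-map that is the identity outside a ball, tested against
radial functions. -/
theorem integral_comp_norm_sq_mul_det_fderiv (μ : Measure E) [μ.IsAddHaarMeasure]
    {G : E → E} (hG : ContDiff ℝ 1 G) {R : ℝ} (hGR : ∀ x, R ≤ ‖x‖ → G x = x) {g : ℝ → ℝ}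
    (hg : Continuous g) :
    ∫ x in closedBall 0 R, g (‖G x‖ ^ 2) * (fderiv ℝ G x).det ∂μ =
      ∫ x in closedBall 0 R, g (‖x‖ ^ 2) ∂μ := by
  have hGc := hG.continuous
  have hdc : Continuous fun x => (fderiv ℝ G x).det :=
    ContinuousLinearMap.continuous_det.comp (hG.continuous_fderiv one_ne_zero)
  have hK := isCompact_closedBall (0 : E) R
  have hint {f : E → ℝ} (hf : Continuous f) : IntegrableOn f (closedBall 0 R) μ :=
    hf.continuousOn.integrableOn_compact hK
  obtain ⟨M, hM⟩ := hK.exists_bound_of_continuousOn (f := fun x => ‖G x‖ ^ 2)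
    (by fun_prop)
  set C := ∫ x in closedBall 0 R, (|(fderiv ℝ G x).det| + 1) ∂μ
  have hC : 0 ≤ C := integral_nonneg fun x => by positivity
  set L := max M (R ^ 2)
  have key : ∀ δ > 0, |∫ x in closedBall 0 R,
      (g (‖G x‖ ^ 2) * (fderiv ℝ G x).det - g (‖x‖ ^ 2)) ∂μ| ≤ δ * C := by
    intro δ hδ
    obtain ⟨P, hP⟩ := exists_polynomial_near_of_continuousOn 0 L g hg.continuousOn δ hδ
    have h1 := integral_polynomial_norm_sq_mul_det_fderiv μ hG hGR P
    have hPc := P.continuous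
    have h2 : ∫ x in closedBall 0 R,
        (P.eval (‖G x‖ ^ 2) * (fderiv ℝ G x).det - P.eval (‖x‖ ^ 2)) ∂μ = 0 := by
      rw [integral_sub (hint (by fun_prop)) (hint (by fun_prop)), h1, sub_self]
    rw [← sub_zero (∫ x in closedBall 0 R, _ ∂μ), ← h2,
      ← integral_sub (hint (by fun_prop)) (hint (by fun_prop)), ← Real.norm_eq_abs,
      ← integral_const_mul]
    refine norm_integral_le_of_norm_le (hint (by fun_prop)) ?_
    refine (ae_restrict_iff' isClosed_closedBall.measurableSet).2 (ae_of_all _ fun x hx => ?_)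
    have e1 := hP (‖G x‖ ^ 2) ⟨by positivity, by
      have := hM x hx
      rw [Real.norm_of_nonneg (by positivity)] at this
      exact this.trans (le_max_left _ _)⟩
    have e2 := hP (‖x‖ ^ 2) ⟨by positivity, by
      rw [mem_closedBall_zero_iff] at hx
      exact (pow_le_pow_left₀ (norm_nonneg _) hx 2).trans (le_max_right _ _)⟩
    have e3 : g (‖G x‖ ^ 2) * (fderiv ℝ G x).det - g (‖x‖ ^ 2) -
        (P.eval (‖G x‖ ^ 2) * (fderiv ℝ G x).det - P.eval (‖x‖ ^ 2)) =
        (P.eval (‖x‖ ^ 2) - g (‖x‖ ^ 2)) -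
          (P.eval (‖G x‖ ^ 2) - g (‖G x‖ ^ 2)) * (fderiv ℝ G x).det := by ring
    rw [e3, Real.norm_eq_abs, mul_add, mul_one, add_comm]
    refine (abs_sub _ _).trans (add_le_add e2.le ?_)
    rw [abs_mul]
    exact mul_le_mul_of_nonneg_right e1.le (abs_nonneg _)
  have h0 : ∫ x in closedBall 0 R,
      (g (‖G x‖ ^ 2) * (fderiv ℝ G x).det - g (‖x‖ ^ 2)) ∂μ = 0 := by
    rw [← abs_nonpos_iff]
    refine le_of_forall_pos_le_add fun ε hε => ?_
    refine (key (ε / (C + 1)) (by positivity)).trans ?_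
    rw [zero_add, div_mul_eq_mul_div, div_le_iff₀ (by positivity)]
    nlinarith
  rwa [integral_sub (hint (by fun_prop)) (hint (by fun_prop)), sub_eq_zero] at h0

end

section
variable {E : Type*} [NormedAddCommGroup E] [InnerProductSpace ℝ E] [FiniteDimensional ℝ E]

open Metric Set Filter Topology in
theorem exists_nhd_injOn_sign_det_eq {G : E → E} (hG : ContDiff ℝ 1 G) {z : E}
    (hz : (fderiv ℝ G z).det ≠ 0) :
    (∃ U, IsOpen U ∧ z ∈ U ∧ InjOn G U ∧
      ∀ x ∈ U, SignType.sign (fderiv ℝ G x).det = SignType.sign (fderiv ℝ G z).det) ∧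
    map G (𝓝 z) = 𝓝 (G z) := by
  have hs : HasStrictFDerivAt G
      (((fderiv ℝ G z).toContinuousLinearEquivOfDetNeZero hz : E ≃L[ℝ] E) : E →L[ℝ] E) z := by
    simpa using hG.contDiffAt.hasStrictFDerivAt one_ne_zero
  refine ⟨?_, hs.map_nhds_eq_of_equiv⟩
  have hdc : Continuous fun x => (fderiv ℝ G x).det :=
    ContinuousLinearMap.continuous_det.comp (hG.continuous_fderiv one_ne_zero)
  have hsign : ∀ᶠ x in 𝓝 z, SignType.sign (fderiv ℝ G x).det =
      SignType.sign (fderiv ℝ G z).det := by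
    rcases lt_or_gt_of_ne hz with h | h
    · filter_upwards [(isOpen_lt hdc continuous_const).mem_nhds h] with x hx
      rw [sign_neg hx, sign_neg h]
    · filter_upwards [(isOpen_lt continuous_const hdc).mem_nhds h] with x hx
      rw [sign_pos hx, sign_pos h]
  obtain ⟨V, hV, hVo, hzV⟩ := _root_.mem_nhds_iff.1 hsign
  refine ⟨(hs.toOpenPartialHomeomorph G).source ∩ V,
    (hs.toOpenPartialHomeomorph G).open_source.inter hVo,
    ⟨hs.mem_toOpenPartialHomeomorph_source, hzV⟩, ?_, fun x hx => hV hx.2⟩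
  exact ((hs.toOpenPartialHomeomorph G).injOn).mono inter_subset_left

open MeasureTheory Metric Set Filter Topology in
/-- A `C¹` self-map of a Euclidean space that is the identity outside a ball and has only
nondegenerate zeros has finitely many zeros, and their signed number is one. -/
theorem sum_sign_det_fderiv_zeros_eq_one {G : E → E} (hG : ContDiff ℝ 1 G) {R : ℝ} (hR : 0 < R)
    (hGR : ∀ x, R ≤ ‖x‖ → G x = x) (hreg : ∀ x, G x = 0 → (fderiv ℝ G x).det ≠ 0) :
    ∃ hZ : {x | G x = 0}.Finite,
      ∑ z ∈ hZ.toFinset, (SignType.sign (fderiv ℝ G z).det : ℤ) = 1 := by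
  borelize E
  let μ : Measure E := Measure.addHaar
  have hGc := hG.continuous
  have hdc : Continuous fun x => (fderiv ℝ G x).det :=
    ContinuousLinearMap.continuous_det.comp (hG.continuous_fderiv one_ne_zero)
  have hZR : ∀ x, G x = 0 → x ∈ ball (0 : E) R := by
    intro x hx
    rw [mem_ball_zero_iff]
    by_contra! hc
    have := hGR x hc
    rw [hx] at this
    rw [← this, norm_zero] at hc
    exact hc.not_gt hR
  choose! U hUo hzU hUinj hUsign using fun z (hz : G z = 0) =>
    (exists_nhd_injOn_sign_det_eq hG (hreg z hz)).1
  have hmap : ∀ z, G z = 0 → ∀ V ∈ 𝓝 z, G '' V ∈ 𝓝 (0 : E) := fun z hz V hV => by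
    have := (exists_nhd_injOn_sign_det_eq hG (hreg z hz)).2
    rw [hz] at this
    rw [← this]
    exact image_mem_map hV
  have hZ : {x | G x = 0}.Finite := by
    have hZc : IsCompact {x | G x = 0} :=
      (isCompact_closedBall (0 : E) R).of_isClosed_subset (isClosed_eq hGc continuous_const)
        fun x hx => ball_subset_closedBall (hZR x hx)
    obtain ⟨t, ht, hcov⟩ := hZc.elim_nhds_subcover U fun z hz => (hUo z hz).mem_nhds (hzU z hz)
    refine t.finite_toSet.subset fun x hx => ?_
    obtain ⟨z, hz, hxz⟩ := mem_iUnion₂.1 (hcov hx)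
    have hz0 := ht z hz
    rw [hUinj z hz0 hxz (hzU z hz0) (Eq.trans hx (Eq.symm hz0))]
    exact hz
  refine ⟨hZ, ?_⟩
  obtain ⟨T, hT, hTd⟩ := hZ.t2_separation
  set W : E → Set E := fun z => U z ∩ T z ∩ ball 0 R with hW
  have hWo : ∀ z, G z = 0 → IsOpen (W z) := fun z hz =>
    ((hUo z hz).inter (hT z).2).inter isOpen_ball
  have hzW : ∀ z, G z = 0 → z ∈ W z := fun z hz => ⟨⟨hzU z hz, (hT z).1⟩, hZR z hz⟩
  set C := closedBall (0 : E) R \ ⋃ z ∈ hZ.toFinset, W z with hC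
  have hWU : IsOpen (⋃ z ∈ hZ.toFinset, W z) :=
    isOpen_biUnion fun z hz => hWo z (by simpa using hz)
  have hCc : IsCompact (G '' C) := ((isCompact_closedBall _ _).diff hWU).image hGc
  have hN : (⋂ z ∈ hZ.toFinset, G '' W z) ∩ (G '' C)ᶜ ∩ ball 0 R ∈ 𝓝 (0 : E) := by
    refine inter_mem (inter_mem ?_ ?_) (ball_mem_nhds _ hR)
    · rw [Filter.biInter_finset_mem]
      intro z hz
      have hz' : G z = 0 := by simpa using hz
      exact hmap z hz' _ ((hWo z hz').mem_nhds (hzW z hz'))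
    · refine hCc.isClosed.isOpen_compl.mem_nhds ?_
      rintro ⟨x, hx, hx0⟩
      exact hx.2 (mem_biUnion (by simpa using hx0) (hzW x hx0))
  obtain ⟨η, hη, hηN⟩ := Metric.mem_nhds_iff.1 hN
  set g : ℝ → ℝ := fun s => max 0 (η ^ 2 - s) with hg
  have hgc : Continuous g := by fun_prop
  have hφ0 : ∀ y : E, y ∉ ball (0 : E) η → g (‖y‖ ^ 2) = 0 := by
    intro y hy
    rw [mem_ball_zero_iff, not_lt] at hy
    exact max_eq_left (by nlinarith)
  set c := ∫ y, g (‖y‖ ^ 2) ∂μ with hc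
  have hcpos : 0 < c := by
    refine Continuous.integral_pos_of_hasCompactSupport_nonneg_nonzero (x := 0) (by fun_prop) ?_
      (fun y => le_max_left _ _) ?_
    · refine HasCompactSupport.intro (isCompact_closedBall (0 : E) η) fun y hy => hφ0 y ?_
      exact fun h => hy (ball_subset_closedBall h)
    · simp [hg, hη.ne']
  have hset : ∀ S : Set E, ball 0 η ⊆ S → ∫ y in S, g (‖y‖ ^ 2) ∂μ = c := fun S hS =>
    setIntegral_eq_integral_of_forall_compl_eq_zero fun y hy => hφ0 y fun h => hy (hS h)
  have hdeg := integral_comp_norm_sq_mul_det_fderiv μ hG hGR hgc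
  rw [hset _ fun y hy => ball_subset_closedBall (hηN hy).2] at hdeg
  have hsub : (⋃ z ∈ hZ.toFinset, W z) ⊆ closedBall (0 : E) R :=
    iUnion₂_subset fun z _ => inter_subset_right.trans ball_subset_closedBall
  rw [setIntegral_eq_of_subset_of_forall_sdiff_eq_zero
    isClosed_closedBall.measurableSet hsub fun x hx => by
      rw [hφ0 _ fun h => (hηN h).1.2 ⟨x, hx, rfl⟩, zero_mul],
    integral_biUnion_finset _ (fun z hz => (hWo z (by simpa using hz)).measurableSet)
      (fun z hz w hw hzw => ((hTd (by simpa using hz) (by simpa using hw) hzw).mono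
        (inter_subset_left.trans inter_subset_right)
        (inter_subset_left.trans inter_subset_right)))
      (fun z _ => ((by fun_prop : Continuous fun x => g (‖G x‖ ^ 2) * (fderiv ℝ G x).det)
        |>.continuousOn.integrableOn_compact (isCompact_closedBall (0 : E) R)).mono_set
          (inter_subset_right.trans ball_subset_closedBall))] at hdeg
  have hloc : ∀ z ∈ hZ.toFinset, ∫ x in W z, g (‖G x‖ ^ 2) * (fderiv ℝ G x).det ∂μ =
      ((SignType.sign (fderiv ℝ G z).det : ℤ) : ℝ) * c := by
    intro z hz
    have hz' : G z = 0 := by simpa using hz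
    have hcv := integral_image_eq_integral_abs_det_fderiv_smul μ (hWo z hz').measurableSet
      (fun x _ => (hG.differentiable one_ne_zero x).hasFDerivAt.hasFDerivWithinAt)
      ((hUinj z hz').mono (inter_subset_left.trans inter_subset_left)) fun y => g (‖y‖ ^ 2)
    rw [hset _ fun y hy => mem_iInter₂.1 (hηN hy).1.1 z hz] at hcv
    rw [hcv, ← integral_const_mul]
    refine setIntegral_congr_fun (hWo z hz').measurableSet fun x hx => ?_
    have h1 := sign_mul_abs (fderiv ℝ G x).det
    rw [hUsign z hz' x hx.1.1] at h1
    simp only [smul_eq_mul, SignType.intCast_cast]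
    conv_lhs => rw [← h1]
    ring
  rw [Finset.sum_congr rfl hloc, ← Finset.sum_mul] at hdeg
  have := mul_right_cancel₀ hcpos.ne' (hdeg.trans (one_mul c).symm)
  exact_mod_cast this

end

section
variable {V : Type*} [NormedAddCommGroup V] [NormedSpace ℂ V]

open MeasureTheory Metric Set Filter Topology in
theorem isOpen_forall_isCompact_det_fderiv_sub_ne_zero {Q : V → V} (hQ : ContDiff ℝ 1 Q)
    {K : Set V} (hK : IsCompact K) :
    IsOpen {A : V →L[ℂ] V | ∀ x ∈ K, Q x = A x →
      (fderiv ℝ Q x - A.restrictScalars ℝ).det ≠ 0} := by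
  have := isCompact_iff_compactSpace.1 hK
  rw [← isClosed_compl_iff]
  have hQc := hQ.continuous
  have hQ' := hQ.continuous_fderiv one_ne_zero
  have hres : Continuous fun A : V →L[ℂ] V => A.restrictScalars ℝ :=
    ContinuousLinearMap.continuous_restrictScalars ℝ
  have hcl : IsClosed {p : K × (V →L[ℂ] V) | Q p.1 = p.2 p.1 ∧
      (fderiv ℝ Q p.1 - p.2.restrictScalars ℝ).det = 0} := by
    refine (isClosed_eq (by fun_prop) (by fun_prop)).inter (isClosed_eq
      (ContinuousLinearMap.continuous_det.comp ?_) continuous_const)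
    exact (hQ'.comp (continuous_subtype_val.comp continuous_fst)).sub (hres.comp continuous_snd)
  convert isClosedMap_snd_of_compactSpace _ hcl using 1
  ext A
  simp only [mem_compl_iff, mem_ofPred_eq, mem_image, Prod.exists, exists_eq_right, Subtype.exists]
  push Not
  simp only [exists_prop]

variable [FiniteDimensional ℂ V]

open MeasureTheory Metric Set Filter Topology in
/-- On the region where a complex functional `l` does not vanish, zero becomes a regular value
after subtracting a small rank-one perturbation `x ↦ l x • c`. -/
theorem exists_small_smulRight_det_fderiv_sub_ne_zero {Q : V → V} (hQ : ContDiff ℝ 1 Q)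
    (l : V →L[ℂ] ℂ) (A : V →L[ℂ] V) {δ : ℝ} (hδ : 0 < δ) :
    ∃ c : V, ‖c‖ < δ ∧ ∀ x, l x ≠ 0 → Q x = (A + l.smulRight c) x →
      (fderiv ℝ Q x - (A + l.smulRight c).restrictScalars ℝ).det ≠ 0 := by
  borelize V
  set g : V → V := fun x => (l x)⁻¹ • (Q x - A x) with hg
  have hQd := hQ.differentiable one_ne_zero
  have hl : Differentiable ℝ fun x => l x := (l.restrictScalars ℝ).differentiable
  have hA : Differentiable ℝ fun x => A x := (A.restrictScalars ℝ).differentiable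
  have hgd : ∀ x, l x ≠ 0 → DifferentiableAt ℝ g x := fun x hx =>
    ((hl x).inv hx).smul ((hQd x).sub (hA x))
  set S : Set V := {x | l x ≠ 0 ∧ (fderiv ℝ g x).det = 0} with hS
  have h0 : (Measure.addHaar : Measure V) (g '' S) = 0 :=
    addHaar_image_eq_zero_of_det_fderivWithin_eq_zero _
      (fun x hx => (hgd x hx.1).hasFDerivAt.hasFDerivWithinAt) fun x hx => hx.2
  have hdense : Dense {c | c ∉ g '' S} :=
    (Measure.addHaar : Measure V).dense_of_ae (measure_eq_zero_iff_ae_notMem.1 h0)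
  obtain ⟨c, hcS, hc⟩ := hdense.exists_dist_lt 0 hδ
  rw [dist_zero_left] at hc
  refine ⟨c, hc, fun x hx hQx hdet => hcS ⟨x, ⟨hx, ?_⟩, ?_⟩⟩
  all_goals
    have hgx : g x = c := by
      rw [hg]
      simp only [hQx, add_apply, ContinuousLinearMap.smulRight_apply,
        add_sub_cancel_left, smul_smul, inv_mul_cancel₀ hx, one_smul]
  · have hd := (l.restrictScalars ℝ).hasFDerivAt (x := x) |>.smul (hgd x hx).hasFDerivAt
    have heq : (fun y => (l.restrictScalars ℝ) y • g y) =ᶠ[𝓝 x] fun y => Q y - A y := by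
      have : ∀ᶠ y in 𝓝 x, l y ≠ 0 := l.continuous.continuousAt.eventually_ne hx
      filter_upwards [this] with y hy
      simp [hg, smul_smul, mul_inv_cancel₀ hy]
    have hd' := ((hQd x).hasFDerivAt.sub (A.restrictScalars ℝ).hasFDerivAt).unique
      (hd.congr_of_eventuallyEq heq.symm)
    obtain ⟨v, hv, hv0⟩ := (Submodule.ne_bot_iff _).1
      (bot_lt_iff_ne_bot.1 (LinearMap.bot_lt_ker_of_det_eq_zero hdet))
    by_contra hne
    have hker := LinearMap.ker_eq_bot'.1 (not_not.1 (mt LinearMap.det_eq_zero_iff_ker_ne_bot.2 hne)) v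
    refine hv0 (hker ?_)
    have h1 := DFunLike.congr_fun hd' v
    simp [hgx] at h1 hv
    have h2 : l x • fderiv ℝ g x v = 0 := by
      rw [← hv, ← sub_sub, h1]
      abel
    exact (smul_eq_zero.1 h2).resolve_left hx
  · exact hgx

open MeasureTheory Metric Set Filter Topology in
/-- Complex-linear transversality: an arbitrarily small complex-linear perturbation of a `C¹` map
has only nondegenerate zeros away from the origin. -/
theorem exists_small_clm_det_fderiv_sub_ne_zero {Q : V → V} (hQ : ContDiff ℝ 1 Q) {ε : ℝ}
    (hε : 0 < ε) :
    ∃ A : V →L[ℂ] V, ‖A‖ < ε ∧ ∀ x, x ≠ 0 → Q x = A x →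
      (fderiv ℝ Q x - A.restrictScalars ℝ).det ≠ 0 := by
  let b := Module.finBasis ℂ V
  let l : Fin (Module.finrank ℂ V) → V →L[ℂ] ℂ := fun i =>
    LinearMap.toContinuousLinearMap (b.coord i)
  let K : Fin (Module.finrank ℂ V) × ℕ → Set V := fun p =>
    closedBall 0 p.2 ∩ {x | 1 ≤ (p.2 : ℝ) * ‖l p.1 x‖}
  have := FiniteDimensional.proper ℂ V
  have hK : ∀ p, IsCompact (K p) := fun p =>
    (isCompact_closedBall _ _).inter_right (isClosed_le (by fun_prop) (by fun_prop))
  have hd := dense_iInter_of_isOpen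
    (fun p => isOpen_forall_isCompact_det_fderiv_sub_ne_zero hQ (hK p)) fun p => by
      rw [Metric.dense_iff]
      intro A r hr
      obtain ⟨c, hc, h⟩ := exists_small_smulRight_det_fderiv_sub_ne_zero hQ (l p.1) A
        (δ := r / (‖l p.1‖ + 1)) (by positivity)
      refine ⟨A + (l p.1).smulRight c, ?_, fun x hx => h x ?_⟩
      · rw [mem_ball, dist_eq_norm, add_sub_cancel_left, ContinuousLinearMap.norm_smulRight_apply]
        rw [lt_div_iff₀ (by positivity)] at hc
        nlinarith [norm_nonneg c, norm_nonneg (l p.1)]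
      · intro h0
        have := hx.2
        simp only [mem_ofPred_eq, h0, norm_zero, mul_zero] at this
        linarith
  obtain ⟨A, hA, hAε⟩ := hd.exists_dist_lt 0 hε
  refine ⟨A, by simpa using hAε, fun x hx => ?_⟩
  obtain ⟨i, hi⟩ : ∃ i, l i x ≠ 0 := by
    by_contra! hc
    exact hx (b.forall_coord_eq_zero_iff.1 hc)
  obtain ⟨k, hk⟩ := exists_nat_ge (max ‖x‖ (1 / ‖l i x‖))
  refine mem_iInter.1 hA (i, k) x ⟨?_, ?_⟩
  · simpa using (le_max_left _ _).trans hk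
  · have := (le_max_right _ _).trans hk
    rwa [div_le_iff₀ (by positivity)] at this

end

theorem prime_dvd_card_of_smul_mem {M : Type*} [AddCommGroup M] [Module ℂ M] {p : ℕ}
    (hp : p.Prime) {ω : ℂ} (hωp : ω ^ p = 1) (hω1 : ω ≠ 1) {s : Finset M}
    (hs : ∀ x ∈ s, ω • x ∈ s) (h0 : (0 : M) ∉ s) : p ∣ s.card := by
  classical
  have := Fact.mk hp
  let f : Function.End s := fun x => ⟨ω • (x : M), hs x x.2⟩
  have hpow : ∀ (n : ℕ) (x : s), (((f ^ n : Function.End s) x : s) : M) = ω ^ n • (x : M) := by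
    intro n
    induction n with
    | zero => exact fun x => (one_smul ℂ (x : M)).symm.trans (by rw [pow_zero])
    | succ n ih =>
      intro x
      rw [pow_succ', pow_succ']
      change ω • (((f ^ n : Function.End s) x : s) : M) = _
      rw [ih, smul_smul]
  have hf : f ^ p ^ 1 = 1 := by
    funext x
    apply Subtype.ext
    rw [hpow, pow_one, hωp, one_smul]
    rfl
  have h := Equiv.Perm.card_fixedPoints_modEq hf
  have hfix : IsEmpty f.fixedPoints := by
    refine ⟨fun ⟨x, hx⟩ => ?_⟩
    have hx' : ω • (x : M) = x := congrArg Subtype.val hx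
    have : (ω - 1) • (x : M) = 0 := by rw [sub_smul, one_smul, hx', sub_self]
    rcases smul_eq_zero.1 this with h | h
    · exact hω1 (sub_eq_zero.1 h)
    · exact h0 (h ▸ x.2)
  rw [Fintype.card_eq_zero (α := f.fixedPoints), Fintype.card_coe] at h
  exact (Nat.modEq_zero_iff_dvd).1 h

section
variable {V : Type*} [NormedAddCommGroup V] [InnerProductSpace ℂ V]

theorem det_fderiv_smul_eq {H : V → V} (hH : Differentiable ℝ H) {ω : ℂ} (hω : ω ≠ 0)
    (hHω : ∀ x, H (ω • x) = ω • H x) (x : V) :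
    (fderiv ℝ H (ω • x)).det = (fderiv ℝ H x).det := by
  let L : V →L[ℝ] V := ω • ContinuousLinearMap.id ℝ V
  let L' : V →L[ℝ] V := ω⁻¹ • ContinuousLinearMap.id ℝ V
  have hL : ∀ y, L y = ω • y := fun y => rfl
  have h1 : HasFDerivAt (fun y => H (L y)) ((fderiv ℝ H (ω • x)).comp L) x :=
    (hH (L x)).hasFDerivAt.comp x L.hasFDerivAt
  have h2 : HasFDerivAt (fun y => L (H y)) (L.comp (fderiv ℝ H x)) x :=
    L.hasFDerivAt.comp x (hH x).hasFDerivAt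
  have h3 : (fun y => H (L y)) = fun y => L (H y) := funext hHω
  rw [h3] at h1
  have h4 := h1.unique h2
  have h5 : (fderiv ℝ H (ω • x) : V →ₗ[ℝ] V) ∘ₗ (L : V →ₗ[ℝ] V) =
      (L : V →ₗ[ℝ] V) ∘ₗ (fderiv ℝ H x : V →ₗ[ℝ] V) :=
    congrArg (fun A : V →L[ℝ] V => (A : V →ₗ[ℝ] V)) h4
  have h6 : (L : V →ₗ[ℝ] V) ∘ₗ (L' : V →ₗ[ℝ] V) = LinearMap.id := by
    ext y
    simp [L, L', smul_smul, mul_inv_cancel₀ hω]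
  have h7 : LinearMap.det (L : V →ₗ[ℝ] V) ≠ 0 := by
    intro h
    have := congrArg LinearMap.det h6
    rw [LinearMap.det_comp, h, zero_mul, LinearMap.det_id] at this
    exact zero_ne_one this
  have h8 := congrArg LinearMap.det h5
  rw [LinearMap.det_comp, LinearMap.det_comp, mul_comm] at h8
  exact mul_left_cancel₀ h7 h8

open Finset in
/-- Averaging a `C¹` approximation over the cyclic group generated by `ω` yields an equivariant
`C¹` map that is still close to the original map wherever the latter is equivariant. -/
theorem exists_contDiff_equivariant_approx {p : ℕ} (hp : p ≠ 0) {ω : ℂ} (hωp : ω ^ p = 1)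
    {F S : V → V} (hS : ContDiff ℝ 1 S) {δ : ℝ} (hSF : ∀ x, ‖S x - F x‖ ≤ δ)
    (hF : ∀ x, 1 ≤ ‖x‖ → F (ω • x) = ω • F x) :
    ∃ T : V → V, ContDiff ℝ 1 T ∧ (∀ x, T (ω • x) = ω • T x) ∧
      ∀ x, 1 ≤ ‖x‖ → ‖T x - F x‖ ≤ δ := by
  have hω0 : ω ≠ 0 := by
    rintro rfl
    simp [hp] at hωp
  have hωn : ‖ω‖ = 1 := norm_eq_one_of_pow_eq_one hωp hp
  have hFk : ∀ x, 1 ≤ ‖x‖ → ∀ k : ℕ, F (ω ^ k • x) = ω ^ k • F x := by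
    intro x hx k
    induction k with
    | zero => simp
    | succ k ih =>
      rw [pow_succ', mul_smul, hF _ (by simpa [norm_smul, hωn] using hx), ih, smul_smul]
  have hpC : (p : ℂ) ≠ 0 := Nat.cast_ne_zero.2 hp
  let u : V → ℕ → V := fun x k => (ω ^ k)⁻¹ • S (ω ^ k • x)
  refine ⟨fun x => (p : ℂ)⁻¹ • ∑ k ∈ range p, u x k, ?_, ?_, ?_⟩
  · refine ContDiff.const_smul _ (ContDiff.sum fun k _ => ContDiff.const_smul _ (hS.comp ?_))
    exact contDiff_id.const_smul (ω ^ k)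
  · intro x
    have h1 : ∀ k, u (ω • x) k = ω • u x (k + 1) := by
      intro k
      simp only [u, smul_smul, ← pow_succ]
      congr 1
      field_simp
      ring
    have h2 : ∑ k ∈ range p, u x (k + 1) = ∑ k ∈ range p, u x k := by
      have h3 := sum_range_succ (u x) p
      rw [sum_range_succ'] at h3
      have h4 : u x p = u x 0 := by simp [u, hωp]
      rw [h4] at h3
      exact add_right_cancel h3
    simp only [h1, ← smul_sum, h2]
    rw [smul_comm]
  · intro x hx
    have h1 : (p : ℂ)⁻¹ • ∑ k ∈ range p, u x k - F x =
        (p : ℂ)⁻¹ • ∑ k ∈ range p, (ω ^ k)⁻¹ • (S (ω ^ k • x) - F (ω ^ k • x)) := by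
      have h2 : ∀ k, (ω ^ k)⁻¹ • (S (ω ^ k • x) - F (ω ^ k • x)) = u x k - F x := by
        intro k
        rw [smul_sub, hFk x hx, smul_smul, inv_mul_cancel₀ (pow_ne_zero k hω0), one_smul]
      simp only [h2, sum_sub_distrib, sum_const, card_range, smul_sub, ← Nat.cast_smul_eq_nsmul ℂ]
      rw [smul_smul (p : ℂ)⁻¹ (p : ℂ), inv_mul_cancel₀ hpC, one_smul]
    rw [h1, norm_smul, norm_inv, Complex.norm_natCast, inv_mul_le_iff₀ (by positivity)]
    refine (norm_sum_le _ _).trans ((sum_le_card_nsmul _ _ δ fun k _ => ?_).trans_eq ?_)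
    · rw [norm_smul, norm_inv, norm_pow, hωn, one_pow, inv_one, one_mul]
      exact hSF _
    · simp

variable [FiniteDimensional ℂ V]

open Metric Set Filter Topology in
/-- A nowhere-vanishing continuous self-map of `ℂⁿ` cannot commute, outside the open unit ball, with
multiplication by a root of unity of prime order. -/
theorem false_of_norm_eq_one_of_equivariant_outside_ball {p : ℕ} (hp : p.Prime) {ω : ℂ}
    (hωp : ω ^ p = 1) (hω1 : ω ≠ 1) {F : V → V} (hFc : Continuous F) (hF1 : ∀ x, ‖F x‖ = 1)
    (hF : ∀ x, 1 ≤ ‖x‖ → F (ω • x) = ω • F x) : False := by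
  let _ : InnerProductSpace ℝ V := InnerProductSpace.complexToReal
  have hω0 : ω ≠ 0 := by
    rintro rfl
    simp [hp.ne_zero] at hωp
  have hωn : ‖ω‖ = 1 := norm_eq_one_of_pow_eq_one hωp hp.ne_zero
  obtain ⟨S, hS, hSF', -⟩ := hFc.exists_contDiff_approx 1 (ε := fun _ => 1 / 4)
    continuous_const (fun _ => by norm_num)
  have hSF : ∀ x, ‖S x - F x‖ ≤ 1 / 4 := fun x => by rw [← dist_eq_norm]; exact (hSF' x).le
  obtain ⟨T, hT, hTω, hTF⟩ := exists_contDiff_equivariant_approx hp.ne_zero hωp hS hSF hF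
  let σ : ℝ → V → ℝ := fun c x => Real.smoothTransition (‖x‖ ^ 2 - c)
  have hσ : ∀ c, ContDiff ℝ 1 (σ c) := fun c =>
    Real.smoothTransition.contDiff.comp ((contDiff_norm_sq ℝ).sub contDiff_const)
  have hσ0 : ∀ c x, ‖x‖ ^ 2 ≤ c → σ c x = 0 := fun c x h =>
    Real.smoothTransition.zero_of_nonpos (by linarith)
  have hσ1 : ∀ c x, c + 1 ≤ ‖x‖ ^ 2 → σ c x = 1 := fun c x h =>
    Real.smoothTransition.one_of_one_le (by linarith)
  have hσω : ∀ c x, σ c (ω • x) = σ c x := fun c x => by simp [σ, norm_smul, hωn]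
  let Q : V → V := fun x => T x + σ 2 x • (x - T x)
  have hQ : ContDiff ℝ 1 Q := hT.add ((hσ 2).smul (contDiff_id.sub hT))
  obtain ⟨A, hAε, hA⟩ := exists_small_clm_det_fderiv_sub_ne_zero hQ (ε := 1 / 8) (by norm_num)
  have hAx : ∀ x, ‖A x‖ ≤ 1 / 8 * ‖x‖ := fun x =>
    (A.le_opNorm x).trans (mul_le_mul_of_nonneg_right hAε.le (norm_nonneg x))
  have hA1 : ContDiff ℝ 1 fun x => A x := (A.restrictScalars ℝ).contDiff
  let H : V → V := fun x => Q x - A x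
  have hH : ContDiff ℝ 1 H := hQ.sub hA1
  have hHω : ∀ x, H (ω • x) = ω • H x := fun x => by
    simp only [H, Q, hTω, hσω, map_smul, smul_sub, smul_add]
    rw [smul_comm ω (σ 2 x) x, smul_comm ω (σ 2 x) (T x)]
  let G : V → V := fun x =>
    S x + σ 1 x • (T x - S x) + σ 2 x • (x - T x) - (1 - σ 3 x) • A x
  have hG : ContDiff ℝ 1 G :=
    ((hS.add ((hσ 1).smul (hT.sub hS))).add ((hσ 2).smul (contDiff_id.sub hT))).sub
      ((contDiff_const.sub (hσ 3)).smul hA1)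
  have hGH : ∀ x, 2 ≤ ‖x‖ ^ 2 → ‖x‖ ^ 2 ≤ 3 → G x = H x := fun x h2 h3 => by
    simp only [G, H, Q, hσ1 1 x (by linarith), hσ0 3 x h3]
    module
  have hGzero : ∀ x, G x = 0 → 2 < ‖x‖ ^ 2 ∧ ‖x‖ ^ 2 < 3 := by
    intro x hx
    constructor
    · by_contra! h2
      have hxn : ‖x‖ ≤ 2 := by nlinarith
      have h3 : ‖S x + σ 1 x • (T x - S x) - F x‖ ≤ 1 / 4 := by
        rcases le_total ‖x‖ 1 with h | h
        · rw [hσ0 1 x (by nlinarith [norm_nonneg x])]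
          simpa using hSF x
        · have e : S x + σ 1 x • (T x - S x) - F x =
              (1 - σ 1 x) • (S x - F x) + σ 1 x • (T x - F x) := by module
          have n0 : 0 ≤ σ 1 x := Real.smoothTransition.nonneg _
          have n1 : σ 1 x ≤ 1 := Real.smoothTransition.le_one _
          rw [e]
          refine (norm_add_le _ _).trans ?_
          rw [norm_smul, norm_smul, Real.norm_of_nonneg n0, Real.norm_of_nonneg (sub_nonneg.2 n1)]
          nlinarith [hSF x, hTF x h]
      have h4 : F x = A x - (S x + σ 1 x • (T x - S x) - F x) := by
        have : G x = S x + σ 1 x • (T x - S x) - A x := by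
          simp only [G, hσ0 2 x h2, hσ0 3 x (by linarith)]
          module
        rw [hx] at this
        rw [← sub_eq_zero.1 this.symm]
        abel
      have h5 := norm_sub_le (A x) (S x + σ 1 x • (T x - S x) - F x)
      rw [← h4, hF1] at h5
      linarith [hAx x]
    · by_contra! h3
      have hGx : G x = x - (1 - σ 3 x) • A x := by
        simp only [G, hσ1 1 x (by linarith), hσ1 2 x (by linarith)]
        module
      have n0 : 0 ≤ σ 3 x := Real.smoothTransition.nonneg _
      have n1 : σ 3 x ≤ 1 := Real.smoothTransition.le_one _
      rw [hx] at hGx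
      have h4 : ‖x‖ = (1 - σ 3 x) * ‖A x‖ := by
        conv_lhs => rw [sub_eq_zero.1 hGx.symm]
        rw [norm_smul, Real.norm_of_nonneg (sub_nonneg.2 n1)]
      have h5 : 0 < ‖x‖ := by
        by_contra! h
        nlinarith [norm_nonneg x]
      nlinarith [hAx x, norm_nonneg (A x)]
  have hGd : ∀ x, G x = 0 → fderiv ℝ G x = fderiv ℝ H x := by
    intro x hx
    obtain ⟨h2, h3⟩ := hGzero x hx
    refine Filter.EventuallyEq.fderiv_eq ?_
    have e2 : ∀ᶠ y in 𝓝 x, 2 < ‖y‖ ^ 2 :=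
      (isOpen_lt continuous_const (by fun_prop)).mem_nhds h2
    have e3 : ∀ᶠ y in 𝓝 x, ‖y‖ ^ 2 < 3 :=
      (isOpen_lt (by fun_prop) continuous_const).mem_nhds h3
    filter_upwards [e2, e3] with y hy2 hy3 using hGH y hy2.le hy3.le
  have hG0 : ∀ x, G x = 0 → x ≠ 0 := by
    rintro x hx rfl
    have := (hGzero 0 hx).1
    norm_num at this
  have hreg : ∀ x, G x = 0 → (fderiv ℝ G x).det ≠ 0 := by
    intro x hx
    obtain ⟨h2, h3⟩ := hGzero x hx
    have hfd : fderiv ℝ H x = fderiv ℝ Q x - A.restrictScalars ℝ :=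
      ((hQ.differentiable one_ne_zero x).hasFDerivAt.sub (A.restrictScalars ℝ).hasFDerivAt).fderiv
    rw [hGd x hx, hfd]
    refine hA x (hG0 x hx) ?_
    rw [hGH x h2.le h3.le] at hx
    exact sub_eq_zero.1 hx
  have hGω : ∀ x, G x = 0 → G (ω • x) = 0 := by
    intro x hx
    obtain ⟨h2, h3⟩ := hGzero x hx
    have hn : ‖ω • x‖ = ‖x‖ := by rw [norm_smul, hωn, one_mul]
    rw [hGH (ω • x) (by rw [hn]; exact h2.le) (by rw [hn]; exact h3.le), hHω,
      ← hGH x h2.le h3.le, hx, smul_zero]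
  have hdetω : ∀ x, G x = 0 → (fderiv ℝ G (ω • x)).det = (fderiv ℝ G x).det := fun x hx => by
    rw [hGd _ (hGω x hx), hGd x hx,
      det_fderiv_smul_eq (hH.differentiable one_ne_zero) hω0 hHω]
  have hGR : ∀ x, 2 ≤ ‖x‖ → G x = x := fun x hx => by
    have : 4 ≤ ‖x‖ ^ 2 := by nlinarith
    simp only [G, hσ1 1 x (by linarith), hσ1 2 x (by linarith), hσ1 3 x (by linarith)]
    module
  obtain ⟨hZ, hsum⟩ := sum_sign_det_fderiv_zeros_eq_one hG two_pos hGR hreg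
  have hdvd : (p : ℤ) ∣ 1 := by
    rw [← hsum, ← Finset.sum_filter_add_sum_filter_not _ fun z => 0 < (fderiv ℝ G z).det]
    refine dvd_add ?_ ?_
    · rw [Finset.sum_congr rfl (g := fun _ => (1 : ℤ)), Finset.sum_const, nsmul_one]
      · refine Int.natCast_dvd_natCast.2 (prime_dvd_card_of_smul_mem hp hωp hω1 ?_ ?_)
        · intro x hx
          simp only [Finset.mem_filter, Finite.mem_toFinset, mem_ofPred_eq] at hx ⊢
          exact ⟨hGω x hx.1, by rw [hdetω x hx.1]; exact hx.2⟩
        · intro h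
          simp only [Finset.mem_filter, Finite.mem_toFinset, mem_ofPred_eq] at h
          exact hG0 0 h.1 rfl
      · intro x hx
        rw [sign_pos (Finset.mem_filter.1 hx).2]
        rfl
    · rw [Finset.sum_congr rfl (g := fun _ => (-1 : ℤ)), Finset.sum_const, nsmul_eq_mul]
      · refine (Int.natCast_dvd_natCast.2
          (prime_dvd_card_of_smul_mem hp hωp hω1 ?_ ?_)).mul_right _
        · intro x hx
          simp only [Finset.mem_filter, Finite.mem_toFinset, mem_ofPred_eq] at hx ⊢
          exact ⟨hGω x hx.1, by rw [hdetω x hx.1]; exact hx.2⟩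
        · intro h
          simp only [Finset.mem_filter, Finite.mem_toFinset, mem_ofPred_eq] at h
          exact hG0 0 h.1 rfl
      · intro x hx
        simp only [Finset.mem_filter, Finite.mem_toFinset, mem_ofPred_eq, not_lt] at hx
        rw [sign_neg (lt_of_le_of_ne hx.2 (hreg x hx.1))]
        rfl
  exact hp.one_lt.ne' (by exact_mod_cast Int.eq_one_of_dvd_one (by positivity) hdvd)

end

theorem exists_continuous_equivariant_map_to_punctured {N m : ℕ} (h : N < m) :
    ∃ ι : EuclideanSpace ℂ (Fin N) → EuclideanSpace ℂ (Fin m), Continuous ι ∧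
      (∀ x, ι x ≠ 0) ∧
      ∀ (ω : ℂ), ‖ω‖ = 1 → ∀ x, 1 ≤ ‖x‖ → ι (ω • x) = ω • ι x := by
  refine ⟨fun x => WithLp.toLp 2 fun i =>
    if hi : (i : ℕ) < N then x ⟨i, hi⟩ else ((max 0 (1 - ‖x‖) : ℝ) : ℂ), ?_, ?_, ?_⟩
  · refine (PiLp.continuous_toLp 2 _).comp (continuous_pi fun i => ?_)
    split_ifs <;> fun_prop
  · intro x hx
    have hi : ∀ i : Fin m,
        (if hi : (i : ℕ) < N then x ⟨i, hi⟩ else ((max 0 (1 - ‖x‖) : ℝ) : ℂ)) = 0 :=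
      fun i => congrArg (fun y : EuclideanSpace ℂ (Fin m) => y i) hx
    have hx0 : x = 0 := by
      ext i
      simpa using hi ⟨i, i.2.trans h⟩
    have := hi ⟨N, h⟩
    simp [hx0] at this
  · intro ω hω x hx
    ext i
    by_cases hi : (i : ℕ) < N
    · simp [hi]
    · simp [hi, norm_smul, hω, hx]

/-- If `m > N ≥ 1` then there is no continuous map between the unit spheres of
`ℂ^m` and `ℂ^N` that is equivariant with respect to multiplication by the primitive
`q`-th root of unity `ζ = exp (2πi/q)` (`q ≥ 2`).  Since `‖ζ‖ = 1`, for a point `x` of the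
unit sphere the point with underlying vector `ζ • ↑x` again lies on the unit sphere;
equivariance is expressed via underlying vectors. -/
theorem no_zeta_equivariant_map_of_gt (q m N : ℕ) (hq : 2 ≤ q) (hN : 1 ≤ N) (h : m > N) :
    ¬ ∃ f : (Metric.sphere (0 : EuclideanSpace ℂ (Fin m)) 1) →
        (Metric.sphere (0 : EuclideanSpace ℂ (Fin N)) 1),
      Continuous f ∧
        ∀ x y : (Metric.sphere (0 : EuclideanSpace ℂ (Fin m)) 1),
          (y : EuclideanSpace ℂ (Fin m)) = Complex.exp (2 * Real.pi * Complex.I / q) • ↑x →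
            (f y : EuclideanSpace ℂ (Fin N)) =
              Complex.exp (2 * Real.pi * Complex.I / q) • ↑(f x) := by
  rintro ⟨f, hfc, hf⟩
  have hζ := Complex.isPrimitiveRoot_exp q (by lia)
  set ζ := Complex.exp (2 * Real.pi * Complex.I / q) with hζdef
  obtain ⟨p, hp, k, rfl⟩ := Nat.exists_prime_and_dvd (show q ≠ 1 by lia)
  have hω : IsPrimitiveRoot (ζ ^ k) p := hζ.pow (by lia) (mul_comm p k)
  have hζn : ‖ζ‖ = 1 := hζ.norm'_eq_one (by lia)
  have hωn : ‖ζ ^ k‖ = 1 := by rw [norm_pow, hζn, one_pow]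
  have hiter : ∀ j : ℕ, ∀ x y : Metric.sphere (0 : EuclideanSpace ℂ (Fin m)) 1,
      (y : EuclideanSpace ℂ (Fin m)) = ζ ^ j • (x : EuclideanSpace ℂ (Fin m)) →
        (f y : EuclideanSpace ℂ (Fin N)) = ζ ^ j • (f x : EuclideanSpace ℂ (Fin N)) := by
    intro j
    induction j with
    | zero =>
      intro x y hxy
      rw [pow_zero, one_smul] at hxy ⊢
      rw [Subtype.ext hxy]
    | succ j ih =>
      intro x y hxy
      have hz : ζ ^ j • (x : EuclideanSpace ℂ (Fin m)) ∈ Metric.sphere 0 1 := by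
        rw [mem_sphere_zero_iff_norm, norm_smul, norm_pow, hζn, one_pow, one_mul]
        exact mem_sphere_zero_iff_norm.1 x.2
      rw [hf ⟨_, hz⟩ y (by rw [hxy, pow_succ', mul_smul]), ih x ⟨_, hz⟩ rfl, smul_smul, pow_succ']
  obtain ⟨ι, hιc, hι0, hιω⟩ := exists_continuous_equivariant_map_to_punctured h
  let ν : EuclideanSpace ℂ (Fin N) → Metric.sphere (0 : EuclideanSpace ℂ (Fin m)) 1 := fun x =>
    ⟨((‖ι x‖⁻¹ : ℝ) : ℂ) • ι x, by
      rw [mem_sphere_zero_iff_norm, norm_smul, Complex.norm_real, norm_inv, norm_norm,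
        inv_mul_cancel₀ (norm_ne_zero_iff.2 (hι0 x))]⟩
  have hνc : Continuous ν := by
    refine Continuous.subtype_mk (Continuous.smul (Complex.continuous_ofReal.comp ?_) hιc) _
    exact hιc.norm.inv₀ fun x => norm_ne_zero_iff.2 (hι0 x)
  refine false_of_norm_eq_one_of_equivariant_outside_ball hp hω.pow_eq_one (hω.ne_one hp.one_lt)
    (F := fun x => (f (ν x) : EuclideanSpace ℂ (Fin N)))
    (continuous_subtype_val.comp (hfc.comp hνc)) (fun x => mem_sphere_zero_iff_norm.1 (f (ν x)).2)
    fun x hx => hiter k _ _ ?_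
  simp only [ν]
  rw [hιω _ hωn x hx, norm_smul, hωn, one_mul, smul_comm]
end

section
/- Dold's theorem on equivariant maps of spheres: Let G be a nontrivial finite group acting continuously and freely on S^n and acting continuously and freely on S^N. If there exists a continuous G-equivariant map f : S^n → S^N (i.e. f(g • x) = g • f(x) for all g ∈ G and x ∈ S^n), then n ≤ N. -/
namespace Dold

open Set Module Metric
open scoped Topology

section GeneralPosition

variable {E F : Type*} [NormedAddCommGroup E] [NormedSpace ℝ E] [FiniteDimensional ℝ E]
  [NormedAddCommGroup F] [NormedSpace ℝ F] [FiniteDimensional ℝ F]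

/-- A continuous map can be approximated uniformly by one without zeros on a given set of dimension
less than that of the target. -/
theorem exists_approx_ne_zero {s : Set E} (hs : dimH s < finrank ℝ F) {f : E → F}
    (hf : Continuous f) {ε : ℝ} (hε : 0 < ε) :
    ∃ g : E → F, Continuous g ∧ (∀ x, dist (g x) (f x) < ε) ∧ ∀ x ∈ s, g x ≠ 0 := by
  obtain ⟨g, hg, hgf, -⟩ := hf.exists_contDiff_approx 1 (ε := fun _ => ε / 2) continuous_const
    (fun _ => by positivity)
  have hd : Dense (g '' s)ᶜ :=
    (hg.contDiffOn (s := univ)).dense_compl_image_of_dimH_lt_finrank convex_univ (subset_univ s) hs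
  obtain ⟨v, hv, hv0⟩ := hd.exists_dist_lt 0 (show 0 < ε / 2 by positivity)
  refine ⟨fun x => g x - v, hg.continuous.sub continuous_const, fun x => ?_, fun x hx h => ?_⟩
  · have h1 := hgf x
    rw [dist_eq_norm] at h1 hv0 ⊢
    have h2 : ‖v‖ < ε / 2 := by simpa using hv0
    calc ‖g x - v - f x‖ = ‖(g x - f x) - v‖ := by congr 1; abel
      _ ≤ ‖g x - f x‖ + ‖v‖ := norm_sub_le _ _
      _ < ε := by linarith
  · exact hv ⟨x, hx, sub_eq_zero.1 h⟩

/-- A map from a closed subset of a low-dimensional compact set to the unit sphere extends to the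
whole compact set. -/
theorem exists_extension_sphere {s t : Set E} (hs : dimH s < finrank ℝ F)
    (ht : IsClosed t) {f : E → sphere (0 : F) 1} (hf : ContinuousOn f t) :
    ∃ g : E → sphere (0 : F) 1, ContinuousOn g s ∧ EqOn g f (t ∩ s) := by
  obtain ⟨φ, hφ⟩ := ContinuousMap.exists_restrict_eq ht
    (⟨fun x => (f x : F), continuous_subtype_val.comp hf.domRestrict⟩ : C(t, F))
  have hφt : ∀ x ∈ t, φ x = f x := fun x hx => by
    simpa using congrArg (fun h : C(t, F) => h ⟨x, hx⟩) hφ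
  obtain ⟨ψ, hψ, hψφ, hψ0⟩ := exists_approx_ne_zero hs φ.continuous (show (0 : ℝ) < 1 / 4 by norm_num)
  set c : Set E := {x | ‖φ x‖ ≤ 1 / 2} with hc
  have hcc : IsClosed c := isClosed_le φ.continuous.norm continuous_const
  have hdis : Disjoint c t := by
    rw [Set.disjoint_left]
    intro x hx hxt
    have : ‖φ x‖ = 1 := by rw [hφt x hxt]; exact norm_eq_of_mem_sphere _
    simp only [hc, mem_ofPred_eq, this] at hx
    norm_num at hx
  obtain ⟨χ, hχ0, hχ1, hχ⟩ := exists_continuous_zero_one_of_isClosed hcc ht hdis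
  set θ : E → F := fun x => ψ x + χ x • (φ x - ψ x) with hθ
  have hθc : Continuous θ := by fun_prop
  have hθ0 : ∀ x ∈ s, θ x ≠ 0 := by
    intro x hx h
    by_cases hxc : x ∈ c
    · apply hψ0 x hx
      have : χ x = 0 := hχ0 hxc
      simpa [hθ, this] using h
    · have h1 : 1 / 2 < ‖φ x‖ := by simpa [hc] using hxc
      have h2 : ‖ψ x - φ x‖ < 1 / 4 := by rw [← dist_eq_norm]; exact hψφ x
      have h3 : φ x = (1 - χ x) • (φ x - ψ x) := by
        have : φ x = θ x + (1 - χ x) • (φ x - ψ x) := by simp only [hθ]; module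
        rw [h, zero_add] at this
        exact this
      have h4 : ‖φ x‖ ≤ 1 * ‖φ x - ψ x‖ := by
        conv_lhs => rw [h3, norm_smul]
        gcongr
        rw [Real.norm_eq_abs, abs_le]
        have := hχ x
        constructor <;> linarith [this.1, this.2]
      rw [norm_sub_rev] at h4
      linarith
  classical
  refine ⟨fun x => if h : θ x = 0 then f x else ⟨‖θ x‖⁻¹ • θ x, by simp [norm_smul, h]⟩, ?_, ?_⟩
  · rw [continuousOn_iff_continuous_domRestrict]
    have : (Subtype.val ∘ s.domRestrict fun x => if h : θ x = 0 then f x else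
        (⟨‖θ x‖⁻¹ • θ x, by simp [norm_smul, h]⟩ : sphere (0 : F) 1)) =
        fun x : s => ‖θ x‖⁻¹ • θ x := by
      ext1 x
      simp [hθ0 x x.2]
    rw [Topology.IsInducing.subtypeVal.continuous_iff, this]
    have h1 : Continuous fun x : s => θ x := hθc.comp continuous_subtype_val
    exact (h1.norm.inv₀ fun x => norm_ne_zero_iff.2 (hθ0 x x.2)).smul h1
  · intro x hx
    have hχx : χ x = 1 := hχ1 hx.1
    have : θ x = f x := by simp [hθ, hχx, hφt x hx.1]
    simp only [hθ0 x hx.2, dite_false]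
    ext1
    simp [this]

end GeneralPosition

/-- The unit sphere of an `n + 1`-dimensional space has dimension less than `n + 1`. -/
theorem dimH_sphere_lt (n : ℕ) :
    dimH (sphere (0 : EuclideanSpace ℝ (Fin (n + 1))) 1) < (n + 1 : ℕ) := by
  set v : EuclideanSpace ℝ (Fin (n + 1)) := EuclideanSpace.single 0 1
  have hv : ‖v‖ = 1 := by simp [v]
  have hsub : sphere (0 : EuclideanSpace ℝ (Fin (n + 1))) 1 ⊆
      range (fun w : (Submodule.span ℝ {v})ᗮ => stereoInvFunAux v (w : EuclideanSpace ℝ (Fin (n + 1)))) ∪ {v} := by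
    intro x hx
    by_cases hxv : x = v
    · exact Or.inr hxv
    · left
      refine ⟨stereoToFun v x, ?_⟩
      have := congrArg Subtype.val (stereo_left_inv hv (x := ⟨x, hx⟩) hxv)
      exact this
  refine (dimH_mono hsub).trans_lt ?_
  rw [dimH_union, dimH_singleton]
  have h1 : finrank ℝ (Submodule.span ℝ {v})ᗮ = n := by
    have : Fact (finrank ℝ (EuclideanSpace ℝ (Fin (n + 1))) = n + 1) := ⟨by simp⟩
    exact Submodule.finrank_orthogonal_span_singleton (by rw [← norm_ne_zero_iff, hv]; norm_num)
  have h2 := ContDiff.dimH_range_le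
    (f := fun w : (Submodule.span ℝ {v})ᗮ => stereoInvFunAux v (w : EuclideanSpace ℝ (Fin (n + 1))))
    (contDiff_stereoInvFunAux.comp (Submodule.subtypeL (Submodule.span ℝ {v})ᗮ).contDiff)
  rw [h1] at h2
  refine max_lt (h2.trans_lt ?_) ?_
  · exact_mod_cast Nat.lt_succ_self n
  · exact_mod_cast Nat.succ_pos n

section Labelling

variable {G Y : Type*} [Group G] [Finite G] [Nontrivial G]

/-- If some function separates every orbit, uniformly, then there is a locally consistent
equivariant labelling. -/
theorem exists_labelling_of_separated [PseudoMetricSpace Y] [CompactSpace Y]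
    [MulAction G Y] [ContinuousConstSMul G Y] {ι : Type*} [Finite ι]
    (u : Y → ι → ℝ) (hu : Continuous u)
    (hsep : ∀ y, ∃ j, ∀ g h : G, g ≠ h → u (g • y) j ≠ u (h • y) j) :
    ∃ (c : Y → ι) (γ : Y → G) (δ : ℝ), 0 < δ ∧ (∀ (g : G) y, c (g • y) = c y) ∧
      (∀ (g : G) y, γ (g • y) = g * γ y) ∧ ∀ y z, dist y z < δ → c y = c z → γ y = γ z := by
  have hcont : ∀ (g : G) j, Continuous fun y => u (g • y) j := fun g j =>
    (continuous_apply j).comp (hu.comp (continuous_const_smul g))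
  obtain ⟨ε, hε, hsepε⟩ : ∃ ε : ℝ, 0 < ε ∧
      ∀ y, ∃ j, ∀ g h : G, g ≠ h → ε < |u (g • y) j - u (h • y) j| := by
    let U : ℕ → Set Y := fun m => {y | ∃ j, ∀ g h : G, g ≠ h →
      1 / ((m : ℝ) + 1) < |u (g • y) j - u (h • y) j|}
    have hUo : ∀ m, IsOpen (U m) := by
      intro m
      have : U m = ⋃ j, ⋂ g : G, ⋂ h : G, ⋂ _ : g ≠ h,
          {y | 1 / ((m : ℝ) + 1) < |u (g • y) j - u (h • y) j|} := by
        ext y; simp [U]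
      rw [this]
      refine isOpen_iUnion fun j => isOpen_iInter_of_finite fun g => isOpen_iInter_of_finite
        fun h => isOpen_iInter_of_finite fun _ => ?_
      exact isOpen_lt continuous_const ((hcont g j).sub (hcont h j)).abs
    have hUmono : Monotone U := by
      intro m m' hmm y ⟨j, hj⟩
      exact ⟨j, fun g h hgh => (Nat.one_div_le_one_div hmm).trans_lt (hj g h hgh)⟩
    have hUcov : (univ : Set Y) ⊆ ⋃ m, U m := by
      intro y _
      obtain ⟨j, hj⟩ := hsep y
      have : ∀ g h : G, ∃ m : ℕ, g ≠ h → 1 / ((m : ℝ) + 1) < |u (g • y) j - u (h • y) j| := by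
        intro g h
        by_cases hgh : g = h
        · exact ⟨0, fun h' => absurd hgh h'⟩
        · obtain ⟨m, hm⟩ := exists_nat_one_div_lt (abs_pos.2 (sub_ne_zero.2 (hj g h hgh)))
          exact ⟨m, fun _ => hm⟩
      choose m hm using this
      obtain ⟨M, hM⟩ := (Set.finite_range fun p : G × G => m p.1 p.2).bddAbove
      refine mem_iUnion.2 ⟨M, j, fun g h hgh => ?_⟩
      exact (Nat.one_div_le_one_div (hM ⟨(g, h), rfl⟩)).trans_lt (hm g h hgh)
    obtain ⟨m, hm⟩ := isCompact_univ.elim_directed_cover U hUo hUcov hUmono.directed_le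
    exact ⟨_, Nat.one_div_pos_of_nat, fun y => hm (mem_univ y)⟩
  let J : Y → Set ι := fun y => {j | ∀ g h : G, g ≠ h → ε < |u (g • y) j - u (h • y) j|}
  have hJ : ∀ (k : G) y, J (k • y) = J y := by
    intro k y
    ext j
    constructor
    · intro h g g' hgg
      simpa [smul_smul] using h (g * k⁻¹) (g' * k⁻¹) (by simpa using hgg)
    · intro h g g' hgg
      simpa [smul_smul] using h (g * k) (g' * k) (by simpa using hgg)
  have hne : Nonempty ι ∨ IsEmpty Y := by
    by_cases h : Nonempty Y
    · exact Or.inl ⟨(hsep h.some).choose⟩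
    · exact Or.inr (not_nonempty_iff.1 h)
  rcases hne with hne | hne
  swap
  · exact ⟨fun y => (hne.false y).elim, fun y => (hne.false y).elim, 1, one_pos,
      fun _ y => (hne.false y).elim, fun _ y => (hne.false y).elim, fun y => (hne.false y).elim⟩
  let c : Y → ι := fun y => Classical.epsilon fun j => j ∈ J y
  have hc : ∀ y, c y ∈ J y := fun y => Classical.epsilon_spec (hsepε y)
  have hcs : ∀ (g : G) y, c (g • y) = c y := fun g y => by simp only [c, hJ]
  have hmax : ∀ y, ∃ g : G, ∀ h, h ≠ g → u (h⁻¹ • y) (c y) + ε < u (g⁻¹ • y) (c y) := by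
    intro y
    obtain ⟨g, hg⟩ := Finite.exists_max fun g : G => u (g⁻¹ • y) (c y)
    refine ⟨g, fun h hh => ?_⟩
    have h1 := hc y g⁻¹ h⁻¹ (fun e => hh (inv_injective e).symm)
    rw [abs_of_nonneg (sub_nonneg.2 (hg h))] at h1
    linarith
  choose γ hγ using hmax
  have huc : ∀ (g : G) j, ∃ δ : ℝ, 0 < δ ∧ ∀ y z, dist y z < δ →
      |u (g⁻¹ • y) j - u (g⁻¹ • z) j| < ε := by
    intro g j
    have := CompactSpace.uniformContinuous_of_continuous (hcont g⁻¹ j)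
    obtain ⟨δ, hδ, h⟩ := Metric.uniformContinuous_iff.1 this ε hε
    exact ⟨δ, hδ, fun y z hyz => h hyz⟩
  choose δ hδ0 hδ using huc
  obtain ⟨δ₀, hδ₀, hle⟩ : ∃ δ₀ : ℝ, 0 < δ₀ ∧ ∀ g j, δ₀ ≤ δ g j := by
    obtain ⟨p, hp⟩ := Finite.exists_min fun p : G × ι => δ p.1 p.2
    exact ⟨_, hδ0 p.1 p.2, fun g j => hp (g, j)⟩
  refine ⟨c, γ, δ₀, hδ₀, hcs, fun g y => ?_, fun y z hyz hcyz => ?_⟩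
  · by_contra hne
    have h1 := hγ y (g⁻¹ * γ (g • y)) (fun e => hne (by rw [← e]; group))
    have h2 := hγ (g • y) (g * γ y) (fun e => hne e.symm)
    simp only [hcs, smul_smul, mul_inv_rev, inv_inv, inv_mul_cancel_right] at h1 h2
    linarith
  · by_contra hne
    have h1 := hγ y (γ z) (fun e => hne e.symm)
    have h2 := hγ z (γ y) hne
    have h3 := abs_lt.1 (hδ (γ y) (c y) y z (hyz.trans_le (hle _ _)))
    have h4 := abs_lt.1 (hδ (γ z) (c y) y z (hyz.trans_le (hle _ _)))
    rw [← hcyz] at h2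
    linarith [h3.1, h3.2, h4.1, h4.2]

/-- The unit sphere `S^N` as a type. -/
abbrev Sph (N : ℕ) : Type := sphere (0 : EuclideanSpace ℝ (Fin (N + 1))) 1

/-- Every free action of a finite group on a sphere `S^N` admits a locally consistent equivariant
labelling by `N + 1` copies of the group. -/
theorem exists_labelling_sphere (N : ℕ) [MulAction G (Sph N)] [ContinuousConstSMul G (Sph N)]
    (hfree : ∀ g : G, g ≠ 1 → ∀ y : Sph N, g • y ≠ y) :
    ∃ (c : Sph N → Fin (N + 1)) (γ : Sph N → G) (δ : ℝ), 0 < δ ∧ (∀ (g : G) y, c (g • y) = c y) ∧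
      (∀ (g : G) y, γ (g • y) = g * γ y) ∧ ∀ y z, dist y z < δ → c y = c z → γ y = γ z := by
  suffices h : ∃ u : C(Sph N, Fin (N + 1) → ℝ),
      ∀ y, ∃ j, ∀ g h : G, g ≠ h → u (g • y) j ≠ u (h • y) j by
    obtain ⟨u, hu⟩ := h
    exact exists_labelling_of_separated u u.continuous hu
  have hinj : ∀ (y : Sph N) (g h : G), g ≠ h → g • y ≠ h • y := by
    intro y g h hgh e
    exact hfree (h⁻¹ * g) (fun e' => hgh (inv_mul_eq_one.1 e').symm) y
      (by rw [mul_smul, e, inv_smul_smul])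
  -- neighbourhoods whose translates are pairwise disjoint
  have hnhds : ∀ y : Sph N, ∃ A : Set (Sph N), A ∈ 𝓝 y ∧ IsClosed A ∧
      ∀ g h : G, g ≠ h → ∀ a ∈ A, ∀ b ∈ A, g • a ≠ h • b := by
    intro y
    have h1 : ∀ g h : G, ∀ᶠ p : Sph N × Sph N in 𝓝 (y, y), g ≠ h → g • p.1 ≠ h • p.2 := by
      intro g h
      by_cases hgh : g = h
      · exact Filter.Eventually.of_forall fun _ e => absurd hgh e
      · have hcl : IsClosed {p : Sph N × Sph N | g • p.1 = h • p.2} :=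
          isClosed_eq (continuous_fst.const_smul g) (continuous_snd.const_smul h)
        filter_upwards [hcl.isOpen_compl.mem_nhds (hinj y g h hgh)] with p hp _ using hp
    have h2 : ∀ᶠ p : Sph N × Sph N in 𝓝 (y, y), ∀ g h : G, g ≠ h → g • p.1 ≠ h • p.2 :=
      Filter.eventually_all.2 fun g => Filter.eventually_all.2 fun h => h1 g h
    rw [nhds_prod_eq] at h2
    obtain ⟨t, ht, h⟩ := Filter.mem_prod_self_iff.1 h2
    obtain ⟨A, hA, hAc, hAt⟩ := exists_mem_nhds_isClosed_subset ht
    exact ⟨A, hA, hAc, fun g k hgk a ha b hb =>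
      (h (mk_mem_prod (hAt ha) (hAt hb)) : ∀ g h : G, g ≠ h → g • a ≠ h • b) g k hgk⟩
  choose A hA hAc hAd using hnhds
  obtain ⟨t, ht⟩ := isCompact_univ.elim_nhds_subcover A fun y _ => hA y
  let D : (Fin (N + 1) → G) → (Fin (N + 1) → G) → C(Sph N, Fin (N + 1) → ℝ) → C(Sph N, Fin (N + 1) → ℝ) :=
    fun a b u => ⟨fun x j => u (a j • x) j - u (b j • x) j, continuous_pi fun j =>
      ((continuous_apply j).comp (u.continuous.comp (continuous_const_smul (a j)))).sub
        ((continuous_apply j).comp (u.continuous.comp (continuous_const_smul (b j))))⟩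
  have hD : ∀ a b, Continuous (D a b) := by
    intro a b
    refine ContinuousMap.continuous_of_continuous_uncurry _ ?_
    refine continuous_pi fun j => ?_
    have h1 : ∀ g : G, Continuous fun p : C(Sph N, Fin (N + 1) → ℝ) × Sph N => p.1 (g • p.2) j := by
      intro g
      have : Continuous fun p : C(Sph N, Fin (N + 1) → ℝ) × Sph N => p.1 (g • p.2) :=
        continuous_eval.comp (continuous_fst.prodMk (continuous_snd.const_smul g))
      exact (continuous_apply j).comp this
    exact (h1 (a j)).sub (h1 (b j))
  let I := {p : t × (Fin (N + 1) → G) × (Fin (N + 1) → G) // ∀ j, p.2.1 j ≠ p.2.2 j}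
  let O : I → Set C(Sph N, Fin (N + 1) → ℝ) := fun p =>
    D p.1.2.1 p.1.2.2 ⁻¹' {v | MapsTo v (A p.1.1) {0}ᶜ}
  have hOo : ∀ p, IsOpen (O p) := fun p =>
    (ContinuousMap.isOpen_setOfPred_mapsTo (hAc _).isCompact isOpen_compl_singleton).preimage
      (hD _ _)
  have hOd : ∀ p, Dense (O p) := by
    rintro ⟨⟨⟨y, hy⟩, a, b⟩, hab⟩
    simp only at hab
    rw [Metric.dense_iff]
    intro u ε hε
    obtain ⟨d, hd⟩ := ContinuousMap.exists_restrict_eq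
      (isClosed_sphere : IsClosed (sphere (0 : EuclideanSpace ℝ (Fin (N + 1))) 1)) (D a b u)
    obtain ⟨w, hw, hwd, hw0⟩ := exists_approx_ne_zero (F := Fin (N + 1) → ℝ)
      (by simpa using dimH_sphere_lt N) d.continuous (half_pos hε)
    let e : C(Sph N, Fin (N + 1) → ℝ) := ⟨fun x => w x - d x, by fun_prop⟩
    have hdx : ∀ x : Sph N, d x = D a b u x := fun x => by
      simpa using congrArg (fun h : C(Sph N, Fin (N + 1) → ℝ) => h x) hd
    have he : ∀ x j, |e x j| < ε / 2 := by
      intro x j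
      have h1 := (norm_le_pi_norm (w x - d x) j).trans_lt (by rw [← dist_eq_norm]; exact hwd x)
      simpa [e] using h1
    have hχ : ∀ j, ∃ χ : C(Sph N, ℝ), EqOn χ 0 ((b j • · ) '' A y) ∧ EqOn χ 1 ((a j • ·) '' A y) ∧
        ∀ x, χ x ∈ Icc (0 : ℝ) 1 := by
      intro j
      refine exists_continuous_zero_one_of_isClosed ?_ ?_ ?_
      · exact (isClosedMap_smul (b j)) _ (hAc y)
      · exact (isClosedMap_smul (a j)) _ (hAc y)
      · rw [Set.disjoint_left]
        rintro _ ⟨x, hx, rfl⟩ ⟨x', hx', h⟩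
        exact hAd y (a j) (b j) (hab j) x' hx' x hx h
    choose χ hχ0 hχ1 hχ using hχ
    let u' : C(Sph N, Fin (N + 1) → ℝ) :=
      ⟨fun x j => u x j + χ j x * e ((a j)⁻¹ • x) j, by
        refine continuous_pi fun j => ?_
        have h1 : Continuous fun x => e ((a j)⁻¹ • x) :=
          e.continuous.comp (continuous_const_smul _)
        exact ((continuous_apply j).comp u.continuous).add
          ((χ j).continuous.mul ((continuous_apply j).comp h1))⟩
    refine ⟨u', ?_, ?_⟩
    · rw [Metric.mem_ball]
      refine lt_of_le_of_lt ((ContinuousMap.dist_le (half_pos hε).le).2 fun x => ?_) (half_lt_self hε)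
      refine (dist_pi_le_iff (half_pos hε).le).2 fun j => ?_
      rw [Real.dist_eq]
      simp only [u', ContinuousMap.coe_mk, add_sub_cancel_left, abs_mul]
      calc |χ j x| * |e ((a j)⁻¹ • x) j| ≤ 1 * (ε / 2) := by
            gcongr
            · rw [abs_of_nonneg (hχ j x).1]; exact (hχ j x).2
            · exact (he _ _).le
        _ = ε / 2 := one_mul _
    · intro x hx h
      apply hw0 x x.2
      have h' : D a b u' x = 0 := h
      rw [← h']
      ext j
      have h0 : χ j (b j • x) = 0 := hχ0 j ⟨x, hx, rfl⟩
      have h1 : χ j (a j • x) = 1 := hχ1 j ⟨x, hx, rfl⟩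
      have h2 := congrFun (hdx x) j
      simp only [D, ContinuousMap.coe_mk] at h2
      simp only [D, u', e, ContinuousMap.coe_mk, h0, h1, inv_smul_smul, Pi.sub_apply, h2]
      ring
  obtain ⟨u, hu⟩ := (dense_iInter_of_isOpen hOo hOd).nonempty
  refine ⟨u, fun y => ?_⟩
  by_contra! hcon
  choose a b hab heq using hcon
  obtain ⟨z, hz, hyz⟩ := mem_iUnion₂.1 (ht.2 (mem_univ y))
  have h1 := mem_iInter.1 hu ⟨(⟨z, hz⟩, a, b), hab⟩
  apply h1 hyz
  ext j
  simp [D, heq j]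

end Labelling

section Join

variable {m : ℕ} {G : Type*} [Group G]

/-- The action of `g` on the coordinate space containing the join of `m` copies of `G`. -/
def shift (g : G) : (Fin m × G → ℝ) →ₗ[ℝ] (Fin m × G → ℝ) :=
  LinearMap.funLeft ℝ ℝ fun v => (v.1, g⁻¹ * v.2)

theorem shift_apply (g : G) (x : Fin m × G → ℝ) (v : Fin m × G) :
    shift g x v = x (v.1, g⁻¹ * v.2) := rfl

theorem shift_shift (g h : G) (x : Fin m × G → ℝ) : shift g (shift h x) = shift (g * h) x := by
  ext v
  simp [shift_apply, mul_assoc]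

theorem shift_one (x : Fin m × G → ℝ) : shift 1 x = x := by
  ext v
  simp [shift_apply]

theorem continuous_shift (g : G) : Continuous (shift (m := m) g) :=
  continuous_pi fun _ => continuous_apply _

theorem shift_single [DecidableEq G] (g : G) (v : Fin m × G) :
    shift g (Pi.single v (1 : ℝ)) = Pi.single (v.1, g * v.2) 1 := by
  ext w
  simp only [shift_apply, Pi.single_apply, Prod.ext_iff, inv_mul_eq_iff_eq_mul]

variable [Fintype G]

/-- The simplex with vertices `(i, a i)` for `i < j`. -/
def joinFace (a : Fin m → G) (j : ℕ) : Set (Fin m × G → ℝ) :=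
  {x | (∀ v, 0 ≤ x v) ∧ ∑ v, x v = 1 ∧ ∀ v, x v ≠ 0 → v.2 = a v.1 ∧ (v.1 : ℕ) < j}

/-- The join of the first `j` copies of `G`. -/
def join (m : ℕ) (G : Type*) [Group G] [Fintype G] (j : ℕ) : Set (Fin m × G → ℝ) :=
  ⋃ a, joinFace a j

omit [Group G] in
theorem convex_joinFace (a : Fin m → G) (j : ℕ) : Convex ℝ (joinFace a j) := by
  intro x hx y hy s t hs ht hst
  refine ⟨fun v => ?_, ?_, fun v hv => ?_⟩
  · have := hx.1 v
    have := hy.1 v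
    simp only [Pi.add_apply, Pi.smul_apply, smul_eq_mul]
    positivity
  · simp [Finset.sum_add_distrib, ← Finset.mul_sum, hx.2.1, hy.2.1, hst]
  · by_cases h : x v = 0
    · exact hy.2.2 v fun h' => hv (by simp [h, h'])
    · exact hx.2.2 v h

omit [Group G] in
theorem isClosed_joinFace (a : Fin m → G) (j : ℕ) : IsClosed (joinFace a j) := by
  have : joinFace a j = (⋂ v, {x | 0 ≤ x v}) ∩ {x | ∑ v, x v = 1} ∩
      ⋂ v, {x | ¬ (v.2 = a v.1 ∧ (v.1 : ℕ) < j) → x v = 0} := by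
    ext x
    simp only [joinFace, mem_ofPred_eq, mem_inter_iff, mem_iInter, and_assoc]
    refine and_congr_right fun _ => and_congr_right fun _ => forall_congr' fun v => ?_
    rw [not_imp_comm]
  rw [this]
  refine ((isClosed_iInter fun v => isClosed_le continuous_const (continuous_apply v)).inter
    (isClosed_eq (by fun_prop) continuous_const)).inter (isClosed_iInter fun v => ?_)
  by_cases h : v.2 = a v.1 ∧ (v.1 : ℕ) < j
  · simp [h]
  · simpa [h] using isClosed_eq (continuous_apply v) continuous_const

theorem isClosed_join (j : ℕ) : IsClosed (join m G j) :=
  isClosed_iUnion_of_finite fun a => isClosed_joinFace a j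

theorem shift_mem_joinFace {a : Fin m → G} {j : ℕ} (g : G) {x : Fin m × G → ℝ}
    (hx : x ∈ joinFace a j) : shift g x ∈ joinFace (fun i => g * a i) j := by
  refine ⟨fun v => hx.1 _, ?_, fun v hv => ?_⟩
  · rw [← hx.2.1]
    exact Fintype.sum_equiv ((Equiv.refl (Fin m)).prodCongr (Equiv.mulLeft g⁻¹)) _ _ fun v => rfl
  · have := hx.2.2 _ hv
    exact ⟨inv_mul_eq_iff_eq_mul.1 this.1, this.2⟩

theorem shift_mem_join {j : ℕ} (g : G) {x : Fin m × G → ℝ} (hx : x ∈ join m G j) :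
    shift g x ∈ join m G j := by
  obtain ⟨a, ha⟩ := mem_iUnion.1 hx
  exact mem_iUnion.2 ⟨_, shift_mem_joinFace g ha⟩

theorem join_mono {i j : ℕ} (h : i ≤ j) : join m G i ⊆ join m G j :=
  iUnion_mono fun _ _ hx => ⟨hx.1, hx.2.1, fun v hv => ⟨(hx.2.2 v hv).1, (hx.2.2 v hv).2.trans_le h⟩⟩

omit [Group G] in
theorem dimH_joinFace_le (a : Fin m → G) {j : ℕ} (hj : j < m) : dimH (joinFace a (j + 1)) ≤ j := by
  classical
  let p : Fin (j + 1) → Fin m × G → ℝ := fun i =>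
    Pi.single (Fin.castLE hj i, a (Fin.castLE hj i)) 1
  have hsub : joinFace a (j + 1) ⊆ convexHull ℝ (range p) := by
    intro x hx
    let s := Finset.univ.filter fun v : Fin m × G => x v ≠ 0
    have h1 : ∑ v ∈ s, x v = 1 := by rw [← hx.2.1, Finset.sum_filter_ne_zero]
    have h2 : ∑ v ∈ s, x v • (Pi.single v 1 : Fin m × G → ℝ) = x := by
      rw [Finset.sum_filter_of_ne (fun v _ h => by contrapose! h; simp [h])]
      ext w
      simp [Finset.sum_apply, Pi.single_apply]
    rw [← h2]
    refine (convex_convexHull ℝ _).sum_mem (fun v _ => hx.1 v) h1 fun v hv => subset_convexHull _ _ ?_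
    have h3 := hx.2.2 v (Finset.mem_filter.1 hv).2
    refine ⟨⟨v.1, h3.2⟩, ?_⟩
    have h4 : Fin.castLE hj ⟨(v.1 : ℕ), h3.2⟩ = v.1 := rfl
    simp only [p, h4, ← h3.1]
  refine (dimH_mono hsub).trans ?_
  rw [Real.Convex.dimH_eq_finrank_vectorSpan (convex_convexHull ℝ (range p))
    ((range_nonempty p).mono (subset_convexHull ℝ _)), ← direction_affineSpan, affineSpan_convexHull,
    direction_affineSpan]
  exact_mod_cast finrank_vectorSpan_range_le ℝ p (Fintype.card_fin _)

theorem dimH_join_le {j : ℕ} (hj : j < m) : dimH (join m G (j + 1)) ≤ j := by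
  rw [join, dimH_iUnion]
  exact iSup_le fun a => dimH_joinFace_le a hj

/-- The join of at most `n + 1` copies of `G` maps equivariantly to every `G`-sphere `S^n`. -/
theorem exists_equivariant_of_join (n : ℕ) [MulAction G (Sph n)] [ContinuousConstSMul G (Sph n)]
    {j : ℕ} (hjm : j ≤ m) (hjn : j ≤ n + 1) :
    ∃ Φ : (Fin m × G → ℝ) → Sph n, ContinuousOn Φ (join m G j) ∧
      ∀ g, ∀ x ∈ join m G j, Φ (shift g x) = g • Φ x := by
  induction j with
  | zero =>
    have h0 : join m G 0 = ∅ := by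
      refine eq_empty_of_forall_notMem fun x hx => ?_
      obtain ⟨a, ha⟩ := mem_iUnion.1 hx
      have h : ∀ v, x v = 0 := fun v => by
        by_contra hv
        exact absurd (ha.2.2 v hv).2 (Nat.not_lt_zero _)
      have := ha.2.1
      simp [h] at this
    refine ⟨fun _ => ⟨EuclideanSpace.single 0 1, by simp⟩, ?_, ?_⟩ <;> simp [h0]
  | succ j ih =>
    obtain ⟨Φ, hΦ, hΦe⟩ := ih (by lia) (by lia)
    have hjm' : j < m := hjm
    obtain ⟨Ψ, hΨ, hΨΦ⟩ := exists_extension_sphere (s := join m G (j + 1)) (t := join m G j)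
      (F := EuclideanSpace ℝ (Fin (n + 1)))
      ((dimH_join_le hjm').trans_lt (by
        rw [finrank_euclideanSpace_fin]; exact_mod_cast (by lia : j < n + 1)))
      (isClosed_join j) hΦ
    have hΨΦ' : ∀ x ∈ join m G j, Ψ x = Φ x := fun x hx =>
      hΨΦ ⟨hx, join_mono (Nat.le_succ j) hx⟩
    let Q : Set (Fin m × G → ℝ) := {x | x ∈ join m G (j + 1) ∧ ∀ g, g ≠ 1 → x (⟨j, hjm'⟩, g) = 0}
    have hQc : IsClosed Q := by
      have : Q = join m G (j + 1) ∩ ⋂ g, ⋂ _ : g ≠ (1 : G), {x | x (⟨j, hjm'⟩, g) = 0} := by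
        ext x; simp [Q]
      rw [this]
      exact (isClosed_join _).inter (isClosed_iInter fun g => isClosed_iInter fun _ =>
        isClosed_eq (continuous_apply _) continuous_const)
    have hex : ∀ x ∈ join m G (j + 1), ∃ g : G, shift g⁻¹ x ∈ Q := by
      intro x hx
      obtain ⟨a, ha⟩ := mem_iUnion.1 hx
      refine ⟨a ⟨j, hjm'⟩, shift_mem_join _ hx, fun g hg => ?_⟩
      by_contra h
      have := (ha.2.2 _ h).1
      simp only [inv_inv] at this
      exact hg (mul_eq_left.1 this)
    have hzero : ∀ x ∈ join m G (j + 1), (∀ g, x (⟨j, hjm'⟩, g) = 0) → x ∈ join m G j := by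
      intro x hx h
      obtain ⟨a, ha⟩ := mem_iUnion.1 hx
      refine mem_iUnion.2 ⟨a, ha.1, ha.2.1, fun v hv => ⟨(ha.2.2 v hv).1, ?_⟩⟩
      refine lt_of_le_of_ne (Nat.lt_succ_iff.1 (ha.2.2 v hv).2) fun e => hv ?_
      have : v = (⟨j, hjm'⟩, v.2) := Prod.ext (Fin.ext e) rfl
      rw [this]
      exact h _
    have hindep : ∀ x g h, shift g⁻¹ x ∈ Q → shift h⁻¹ x ∈ Q →
        g • Ψ (shift g⁻¹ x) = h • Ψ (shift h⁻¹ x) := by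
      intro x g h hg hh
      have hx : x ∈ join m G (j + 1) := by
        simpa [shift_shift, shift_one] using shift_mem_join g hg.1
      by_cases hxj : x ∈ join m G j
      · rw [hΨΦ' _ (shift_mem_join _ hxj), hΨΦ' _ (shift_mem_join _ hxj), hΦe _ _ hxj, hΦe _ _ hxj,
          smul_inv_smul, smul_inv_smul]
      · obtain ⟨k, hk⟩ : ∃ k, x (⟨j, hjm'⟩, k) ≠ 0 := by
          by_contra! hcon
          exact hxj (hzero x hx hcon)
        have key : ∀ g : G, shift g⁻¹ x ∈ Q → g = k := by
          intro g hg
          by_contra hne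
          apply hk
          have := hg.2 (g⁻¹ * k) (fun e => hne (inv_mul_eq_one.1 e))
          simpa [shift_apply] using this
        rw [key g hg, key h hh]
    classical
    let Φ' : (Fin m × G → ℝ) → Sph n := fun x =>
      if hx : ∃ g : G, shift g⁻¹ x ∈ Q then hx.choose • Ψ (shift hx.choose⁻¹ x) else Φ x
    have hΦ' : ∀ x g, shift g⁻¹ x ∈ Q → Φ' x = g • Ψ (shift g⁻¹ x) := by
      intro x g hg
      have hx : ∃ g : G, shift g⁻¹ x ∈ Q := ⟨g, hg⟩
      simp only [Φ', dif_pos hx]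
      exact hindep x _ _ hx.choose_spec hg
    refine ⟨Φ', ?_, ?_⟩
    · have hcov : join m G (j + 1) ⊆ ⋃ g : G, (shift g⁻¹) ⁻¹' Q := fun x hx => by
        simpa using hex x hx
      refine ContinuousOn.mono ?_ hcov
      refine (locallyFinite_of_finite _).continuousOn_iUnion
        (fun g => hQc.preimage (continuous_shift _)) fun g => ?_
      refine ContinuousOn.congr (f := fun x => g • Ψ (shift g⁻¹ x)) ?_ fun x hx => hΦ' x g hx
      refine ContinuousOn.const_smul ?_ g
      exact hΨ.comp (continuous_shift _).continuousOn fun x hx => hx.1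
    · intro g x hx
      obtain ⟨h, hh⟩ := hex x hx
      have h1 : shift (g * h)⁻¹ (shift g x) = shift h⁻¹ x := by
        rw [shift_shift]; congr 1; group
      rw [hΦ' x h hh, hΦ' (shift g x) (g * h) (by rw [h1]; exact hh), h1, mul_smul]

end Join

noncomputable section Chains

variable (K : Type*) [CommRing K] {V W : Type*}

/-- The augmented ordered chains on `V`: formal linear combinations of lists. -/
abbrev Chain (V : Type*) := List V →₀ K

/-- The cone operator with apex `a`. -/
def coneMap (a : V) : Chain K V →ₗ[K] Chain K V := Finsupp.lmapDomain K K (List.cons a)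

/-- The map of chains induced by a map of vertices. -/
def mapChain (f : V → W) : Chain K V →ₗ[K] Chain K W := Finsupp.lmapDomain K K (List.map f)

/-- The boundary of a single list. -/
def boundaryList : List V → Chain K V
  | [] => 0
  | a :: l => Finsupp.single l 1 - coneMap K a (boundaryList l)

/-- The augmented boundary operator. -/
def boundary : Chain K V →ₗ[K] Chain K V := Finsupp.linearCombination K (boundaryList K)

/-- The (one-term or norm) elements of the periodic resolution of a cyclic group of order `p`. -/
def resElt {A : Type*} [Ring A] (T : A) (p k : ℕ) : A :=
  if Even k then ∑ i ∈ Finset.range p, T ^ i else T - 1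

variable {K}

theorem eq_of_mem_supported {α M : Type*} [AddCommGroup M] [Module K M] {F F' : (α →₀ K) →ₗ[K] M}
    {S : Set α} (h : ∀ a ∈ S, F (Finsupp.single a 1) = F' (Finsupp.single a 1)) {c : α →₀ K}
    (hc : c ∈ Finsupp.supported K K S) : F c = F' c := by
  rw [Finsupp.supported_eq_span_single] at hc
  refine LinearMap.eqOn_span (s := (fun i => Finsupp.single i (1 : K)) '' S) ?_ hc
  rintro _ ⟨a, ha, rfl⟩
  exact h a ha

theorem eq_of_single {α M : Type*} [AddCommGroup M] [Module K M] {F F' : (α →₀ K) →ₗ[K] M}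
    (h : ∀ a, F (Finsupp.single a 1) = F' (Finsupp.single a 1)) : F = F' :=
  LinearMap.ext fun c => eq_of_mem_supported (S := univ) (fun a _ => h a)
    (by rw [Finsupp.supported_univ]; trivial)

theorem map_mem_of_mem_supported {α M : Type*} [AddCommGroup M] [Module K M] {F : (α →₀ K) →ₗ[K] M}
    {S : Set α} {P : Submodule K M} (h : ∀ a ∈ S, F (Finsupp.single a 1) ∈ P) {c : α →₀ K}
    (hc : c ∈ Finsupp.supported K K S) : F c ∈ P := by
  rw [Finsupp.supported_eq_span_single] at hc
  refine (Submodule.span_le (p := P.comap F)).2 ?_ hc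
  rintro _ ⟨a, ha, rfl⟩
  exact h a ha

theorem single_mem_supported' {α : Type*} {S : Set α} {a : α} (h : a ∈ S) :
    Finsupp.single a (1 : K) ∈ Finsupp.supported K K S :=
  Finsupp.single_mem_supported K 1 h

@[simp] theorem coneMap_single (a : V) (l : List V) (r : K) :
    coneMap K a (Finsupp.single l r) = Finsupp.single (a :: l) r := by
  simp [coneMap]

@[simp] theorem mapChain_single (f : V → W) (l : List V) (r : K) :
    mapChain K f (Finsupp.single l r) = Finsupp.single (l.map f) r := by
  simp [mapChain]

theorem boundary_single (l : List V) : boundary K (Finsupp.single l 1) = boundaryList K l := by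
  simp [boundary]

@[simp] theorem boundary_single_nil : boundary K (Finsupp.single ([] : List V) 1) = 0 := by
  rw [boundary_single, boundaryList]

theorem boundary_coneMap (a : V) (c : Chain K V) :
    boundary K (coneMap K a c) = c - coneMap K a (boundary K c) := by
  have : boundary K ∘ₗ coneMap K a = LinearMap.id - coneMap K a ∘ₗ boundary K :=
    eq_of_single fun l => by simp [boundary_single, boundaryList]
  exact LinearMap.congr_fun this c

theorem boundary_boundary (c : Chain K V) : boundary K (boundary K c) = 0 := by
  have : boundary K ∘ₗ boundary K = (0 : Chain K V →ₗ[K] Chain K V) := eq_of_single fun l => by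
    induction l with
    | nil => simp
    | cons a l ih =>
      simp only [LinearMap.comp_apply, LinearMap.zero_apply] at ih ⊢
      rw [← coneMap_single, boundary_coneMap, map_sub, boundary_coneMap, ih]
      simp
  exact LinearMap.congr_fun this c

theorem mapChain_coneMap (f : V → W) (a : V) (c : Chain K V) :
    mapChain K f (coneMap K a c) = coneMap K (f a) (mapChain K f c) := by
  have : mapChain K f ∘ₗ coneMap K a = coneMap K (f a) ∘ₗ mapChain K f :=
    eq_of_single fun l => by simp
  exact LinearMap.congr_fun this c

theorem boundary_mapChain (f : V → W) (c : Chain K V) :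
    boundary K (mapChain K f c) = mapChain K f (boundary K c) := by
  have : boundary K ∘ₗ mapChain K f = mapChain K f ∘ₗ boundary K := eq_of_single fun l => by
    induction l with
    | nil => simp
    | cons a l ih =>
      simp only [LinearMap.comp_apply] at ih ⊢
      rw [← coneMap_single, mapChain_coneMap, boundary_coneMap, boundary_coneMap, map_sub,
        mapChain_coneMap, ih]
  exact LinearMap.congr_fun this c

theorem boundaryList_mem_supported (l : List V) :
    boundaryList K l ∈ Finsupp.supported K K {l' | ∃ i < l.length, l' = l.eraseIdx i} := by
  induction l with
  | nil => exact Submodule.zero_mem _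
  | cons a l ih =>
    refine Submodule.sub_mem _ (single_mem_supported' ⟨0, by simp, by simp⟩) ?_
    refine map_mem_of_mem_supported ?_ ih
    rintro _ ⟨i, hi, rfl⟩
    rw [coneMap_single]
    exact single_mem_supported' ⟨i + 1, by simpa using hi, by simp⟩

/-- The chains supported on lists with two equal consecutive entries. -/
def degenerate (K : Type*) [CommRing K] (V : Type*) : Submodule K (Chain K V) :=
  Finsupp.supported K K {l | ¬ l.IsChain (· ≠ ·)}

theorem coneMap_mem_degenerate (a : V) {c : Chain K V} (hc : c ∈ degenerate K V) :
    coneMap K a c ∈ degenerate K V := by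
  refine map_mem_of_mem_supported (fun l hl => ?_) hc
  rw [coneMap_single]
  exact single_mem_supported' fun h => hl h.tail

theorem boundaryList_mem_degenerate {l : List V} (hl : ¬ l.IsChain (· ≠ ·)) :
    boundaryList K l ∈ degenerate K V := by
  induction l with
  | nil => simp at hl
  | cons a l ih =>
    rcases l with _ | ⟨b, l⟩
    · simp at hl
    by_cases hab : a = b
    · subst hab
      have : boundaryList K (a :: a :: l) = coneMap K a (coneMap K a (boundaryList K l)) := by
        simp [boundaryList]
      rw [this]
      have : boundaryList K l ∈ Finsupp.supported K K univ := by
        rw [Finsupp.supported_univ]; trivial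
      refine map_mem_of_mem_supported (F := coneMap K a ∘ₗ coneMap K a) (fun l _ => ?_) this
      simp only [LinearMap.comp_apply, coneMap_single]
      exact single_mem_supported' (by simp)
    · have hl' : ¬ (b :: l).IsChain (· ≠ ·) := fun h => hl (by simpa [hab] using h)
      exact Submodule.sub_mem _ (single_mem_supported' hl') (coneMap_mem_degenerate a (ih hl'))

theorem boundary_mem_degenerate {c : Chain K V} (hc : c ∈ degenerate K V) :
    boundary K c ∈ degenerate K V :=
  map_mem_of_mem_supported (fun l hl => by
    rw [boundary_single]; exact boundaryList_mem_degenerate hl) hc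

theorem mapChain_pow_single (τ : V → V) (i : ℕ) (l : List V) (r : K) :
    (mapChain K τ ^ i : Module.End K (Chain K V)) (Finsupp.single l r) =
      Finsupp.single (l.map τ^[i]) r := by
  induction i with
  | zero => simp
  | succ i ih =>
    rw [pow_succ', Module.End.mul_apply, ih, mapChain_single, List.map_map, Function.iterate_succ']

theorem mapChain_pow_eq_one {τ : V → V} {p : ℕ} (h : τ^[p] = id) :
    (mapChain K τ ^ p : Module.End K (Chain K V)) = 1 :=
  eq_of_single fun l => by rw [mapChain_pow_single, h]; simp

theorem resElt_mul {A : Type*} [Ring A] {T : A} {p : ℕ} (h : T ^ p = 1) (k : ℕ) :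
    resElt T p (k + 1) * resElt T p k = 0 := by
  by_cases hk : Even k
  · have : ¬ Even (k + 1) := by simpa [Nat.even_add_one] using hk
    simp [resElt, hk, this, mul_geom_sum, h]
  · have : Even (k + 1) := by simpa [Nat.even_add_one] using hk
    simp [resElt, hk, this, geom_sum_mul, h]

/-- A linear map intertwining two endomorphisms on a stable submodule intertwines the corresponding
elements of the resolutions. -/
theorem map_resElt {A B : Type*} [AddCommGroup A] [Module K A] [AddCommGroup B] [Module K B]
    {T : Module.End K A} {T' : Module.End K B} {F : A →ₗ[K] B} {P : Submodule K A}
    (hP : ∀ c ∈ P, T c ∈ P) (hF : ∀ c ∈ P, F (T c) = T' (F c)) (p k : ℕ) {c : A} (hc : c ∈ P) :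
    resElt T p k c ∈ P ∧ F (resElt T p k c) = resElt T' p k (F c) := by
  have hpow : ∀ i : ℕ, (T ^ i) c ∈ P ∧ F ((T ^ i) c) = (T' ^ i) (F c) := by
    intro i
    induction i with
    | zero => simpa using hc
    | succ i ih =>
      rw [pow_succ', pow_succ', Module.End.mul_apply, Module.End.mul_apply, hF _ ih.1, ih.2]
      exact ⟨hP _ ih.1, rfl⟩
  unfold resElt
  split_ifs with hk
  · simp only [LinearMap.sum_apply, map_sum]
    exact ⟨Submodule.sum_mem _ fun i _ => (hpow i).1, Finset.sum_congr rfl fun i _ => (hpow i).2⟩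
  · simp only [LinearMap.sub_apply, Module.End.one_apply, map_sub, hF c hc]
    exact ⟨Submodule.sub_mem _ (hP c hc) hc, trivial⟩

theorem boundary_resElt (τ : V → V) (p k : ℕ) (c : Chain K V) :
    boundary K (resElt (mapChain K τ) p k c) = resElt (mapChain K τ) p k (boundary K c) :=
  (map_resElt (T := mapChain K τ) (T' := mapChain K τ) (F := boundary K) (P := ⊤)
    (fun _ _ => trivial) (fun c _ => boundary_mapChain τ c) p k (c := c) trivial).2

/-- A partial chain map from the periodic resolution of a cyclic group of order `p`, up to degree
`M`, to the chains on `V` supported in `S`. -/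
structure IsRes (τ : V → V) (p M : ℕ) (S : Set (List V)) (c : ℕ → Chain K V) : Prop where
  mem : ∀ k ≤ M, c k ∈ Finsupp.supported K K {l | l.length = k + 1 ∧ l ∈ S}
  boundary_zero : boundary K (c 0) = Finsupp.single [] 1
  boundary_succ : ∀ k < M, boundary K (c (k + 1)) = resElt (mapChain K τ) p (k + 1) (c k)

theorem IsRes.map {τ : V → V} {τ' : W → W} {p M : ℕ} {S : Set (List V)} {S' : Set (List W)}
    {c : ℕ → Chain K V} (h : IsRes τ p M S c) {F : Chain K V →ₗ[K] Chain K W}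
    (hnil : F (Finsupp.single [] 1) = Finsupp.single [] 1)
    (hbd : ∀ c, boundary K (F c) = F (boundary K c)) (hS : ∀ l ∈ S, l.map τ ∈ S)
    (hτ : ∀ l ∈ S, F (Finsupp.single (l.map τ) 1) = mapChain K τ' (F (Finsupp.single l 1)))
    (hF : ∀ l ∈ S, l.length ≤ M + 1 →
      F (Finsupp.single l 1) ∈ Finsupp.supported K K {L | L.length = l.length ∧ L ∈ S'}) :
    IsRes τ' p M S' fun k => F (c k) where
  mem k hk := by
    refine map_mem_of_mem_supported ?_ (h.mem k hk)
    rintro l ⟨hl, hlS⟩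
    have := hF l hlS (by lia)
    rwa [hl] at this
  boundary_zero := by rw [hbd, h.boundary_zero, hnil]
  boundary_succ k hk := by
    rw [hbd, h.boundary_succ k hk]
    refine (map_resElt (P := Finsupp.supported K K S) (fun c hc => ?_) (fun c hc => ?_) p (k + 1)
      (Finsupp.supported_mono (fun l hl => hl.2) (h.mem k hk.le))).2
    · refine map_mem_of_mem_supported (fun l hl => ?_) hc
      rw [mapChain_single]
      exact single_mem_supported' (hS l hl)
    · exact eq_of_mem_supported (F := F ∘ₗ mapChain K τ) (F' := mapChain K τ' ∘ₗ F)
        (fun l hl => by simpa using hτ l hl) hc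

/-- The standard resolution sequence on the infinite join of copies of `G`. -/
def standardRes (K : Type*) [CommRing K] {G : Type*} [Group G] (g : G) (p : ℕ) :
    ℕ → Chain K (ℕ × G)
  | 0 => Finsupp.single [(0, 1)] 1
  | k + 1 => coneMap K (k + 1, 1)
      (resElt (mapChain K fun v : ℕ × G => (v.1, g * v.2)) p (k + 1) (standardRes K g p k))

theorem isRes_standardRes {G : Type*} [Group G] (g : G) {p : ℕ} (hg : g ^ p = 1) (M : ℕ) :
    IsRes (fun v : ℕ × G => (v.1, g * v.2)) p M
      {l | (∀ v ∈ l, v.1 ≤ M) ∧ ∃ a : ℕ → G, ∀ v ∈ l, v.2 = a v.1} (standardRes K g p) := by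
  set τ : ℕ × G → ℕ × G := fun v => (v.1, g * v.2) with hτ
  have hτi : ∀ i v, τ^[i] v = (v.1, g ^ i * v.2) := by
    intro i v
    induction i with
    | zero => simp
    | succ i ih => rw [Function.iterate_succ', Function.comp_apply, ih, pow_succ', mul_assoc]
  have hT : (mapChain K τ ^ p : Module.End K (Chain K (ℕ × G))) = 1 :=
    mapChain_pow_eq_one (funext fun v => by simp [hτi, hg])
  have hmem : ∀ k, standardRes K g p k ∈ Finsupp.supported K K
      {l : List (ℕ × G) | l.length = k + 1 ∧ (∀ v ∈ l, v.1 ≤ k) ∧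
        ∃ a : ℕ → G, ∀ v ∈ l, v.2 = a v.1} := by
    intro k
    induction k with
    | zero => exact single_mem_supported' ⟨rfl, by simp, fun _ => 1, by simp⟩
    | succ k ih =>
      have h1 := (map_resElt (T := mapChain K τ) (T' := mapChain K τ) (F := LinearMap.id)
        (P := Finsupp.supported K K {l : List (ℕ × G) | l.length = k + 1 ∧ (∀ v ∈ l, v.1 ≤ k) ∧
          ∃ a : ℕ → G, ∀ v ∈ l, v.2 = a v.1}) (fun c hc => ?_) (fun _ _ => rfl) p (k + 1) ih).1
      · refine map_mem_of_mem_supported ?_ h1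
        rintro l ⟨hl, hlk, a, ha⟩
        rw [coneMap_single]
        refine single_mem_supported' ⟨by simp [hl], ?_, Function.update a (k + 1) 1, ?_⟩
        · simp only [List.mem_cons, forall_eq_or_imp, le_refl, true_and]
          exact fun v hv => (hlk v hv).trans (Nat.le_succ k)
        · simp only [List.mem_cons, forall_eq_or_imp, Function.update_self, true_and]
          intro v hv
          rw [Function.update_of_ne (by have := hlk v hv; lia), ha v hv]
      · refine map_mem_of_mem_supported ?_ hc
        rintro l ⟨hl, hlk, a, ha⟩
        rw [mapChain_single]
        refine single_mem_supported' ⟨by simp [hl], ?_, fun i => g * a i, ?_⟩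
        · simp only [List.mem_map]
          rintro _ ⟨v, hv, rfl⟩
          exact hlk v hv
        · simp only [List.mem_map]
          rintro _ ⟨v, hv, rfl⟩
          simp only [hτ, ha v hv]
  have hb0 : boundary K (standardRes K g p 0) = Finsupp.single [] 1 := by
    simp [standardRes, boundary_single, boundaryList]
  have hsucc : ∀ k, standardRes K g p (k + 1) =
      coneMap K (k + 1, 1) (resElt (mapChain K τ) p (k + 1) (standardRes K g p k)) := fun _ => rfl
  have hzero : ∀ k c, resElt (mapChain K τ) p (k + 1) (resElt (mapChain K τ) p k c) = 0 :=
    fun k c => LinearMap.congr_fun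
      (resElt_mul (A := Module.End K (Chain K (ℕ × G))) (T := mapChain K τ) hT k) c
  refine ⟨fun k hk => Finsupp.supported_mono ?_ (hmem k), hb0, fun k _ => ?_⟩
  · rintro l ⟨hl, hlk, h⟩
    exact ⟨hl, fun v hv => (hlk v hv).trans hk, h⟩
  · induction k with
    | zero =>
      rw [hsucc, boundary_coneMap, boundary_resElt, hb0]
      simp [resElt]
    | succ k ih =>
      rw [hsucc, boundary_coneMap, boundary_resElt, ih (by lia), hzero, map_zero, sub_zero]

section Cochains

variable {p : ℕ} [NeZero p]

omit [NeZero p] in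
theorem map_add_not_isChain {l : List (ZMod p)} (hl : ¬ l.IsChain (· ≠ ·)) (x : ZMod p) :
    ¬ (l.map (· + x)).IsChain (· ≠ ·) := by
  rw [List.isChain_map]
  simpa using hl

omit [NeZero p] in
theorem iterate_add_one (i : ℕ) : (· + 1 : ZMod p → ZMod p)^[i] = (· + (i : ZMod p)) := by
  ext x; simp

theorem exists_primitive_of_norm {α : Chain K (ZMod p) →ₗ[K] K}
    (hd : ∀ c ∈ degenerate K (ZMod p), α c = 0) (hnil : α (Finsupp.single [] 1) = 0)
    (hα : α ∘ₗ (∑ i ∈ Finset.range p, (mapChain K (· + 1) : Module.End K (Chain K (ZMod p))) ^ i) = 0) :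
    ∃ η : Chain K (ZMod p) →ₗ[K] K, (∀ c ∈ degenerate K (ZMod p), η c = 0) ∧
      η ∘ₗ (mapChain K (· + 1) - 1) = α := by
  let A : List (ZMod p) → ZMod p → ℕ → K := fun l x n =>
    ∑ j ∈ Finset.range n, α (Finsupp.single (l.map (· + ((j : ZMod p) - x))) 1)
  let e : List (ZMod p) → K := fun l => match l with
    | [] => 0
    | a :: l => A (a :: l) a a.val
  have hper : ∀ l x, Function.Periodic (A l x) p := by
    intro l x n
    have h0 := LinearMap.congr_fun hα (Finsupp.single (l.map (· + ((n : ZMod p) - x))) 1)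
    simp only [LinearMap.comp_apply, LinearMap.sum_apply, mapChain_pow_single, map_sum,
      iterate_add_one, List.map_map, LinearMap.zero_apply] at h0
    simp only [A, Finset.sum_range_add]
    rw [add_eq_left, ← h0]
    refine Finset.sum_congr rfl fun i _ => ?_
    congr 2
    refine congrArg₂ _ (funext fun y => ?_) rfl
    simp only [Function.comp_apply]
    push_cast
    ring
  refine ⟨Finsupp.linearCombination K e, fun c hc => ?_, eq_of_single fun l => ?_⟩
  · refine (Submodule.mem_bot K).1 (map_mem_of_mem_supported (fun l hl => ?_) hc)
    rw [Finsupp.linearCombination_single, one_smul, Submodule.mem_bot]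
    rcases l with _ | ⟨a, l⟩
    · rfl
    · exact Finset.sum_eq_zero fun j _ => hd _ (single_mem_supported' (map_add_not_isChain hl _))
  · simp only [LinearMap.comp_apply, LinearMap.sub_apply, mapChain_single, Module.End.one_apply,
      map_sub, Finsupp.linearCombination_single, one_smul]
    rcases l with _ | ⟨a, l⟩
    · simp [e, hnil]
    · have h1 : e ((a :: l).map (· + 1)) = A (a :: l) a (a.val + 1) := by
        rw [← (hper (a :: l) a).map_mod_nat (a.val + 1)]
        have : (a + 1).val = (a.val + 1) % p := by
          rw [ZMod.val_add, ZMod.val_one_eq_one_mod, Nat.add_mod_mod]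
        rw [← this]
        simp only [e, A, List.map_cons, List.map_map]
        refine Finset.sum_congr rfl fun j _ => ?_
        congr 2
        refine congrArg₂ _ ?_ (List.map_congr_left fun y _ => ?_)
        · ring
        · simp only [Function.comp_apply]
          ring
      rw [h1]
      simp only [e, A]
      rw [Finset.sum_range_succ, add_sub_cancel_left]
      simp

theorem exists_primitive_of_invariant {α : Chain K (ZMod p) →ₗ[K] K}
    (hd : ∀ c ∈ degenerate K (ZMod p), α c = 0) (hnil : α (Finsupp.single [] 1) = 0)
    (hα : α ∘ₗ (mapChain K (· + 1) - 1) = 0) :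
    ∃ η : Chain K (ZMod p) →ₗ[K] K, (∀ c ∈ degenerate K (ZMod p), η c = 0) ∧
      η ∘ₗ (∑ i ∈ Finset.range p, (mapChain K (· + 1) : Module.End K (Chain K (ZMod p))) ^ i) =
        α := by
  let e : List (ZMod p) → K := fun l =>
    if l.head? = some 0 then α (Finsupp.single l 1) else 0
  have hinv : ∀ (i : ℕ) (l : List (ZMod p)),
      α (Finsupp.single (l.map (· + (i : ZMod p))) 1) = α (Finsupp.single l 1) := by
    intro i l
    induction i with
    | zero => simp
    | succ i ih =>
      have h0 := LinearMap.congr_fun hα (Finsupp.single (l.map (· + (i : ZMod p))) 1)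
      simp only [LinearMap.comp_apply, LinearMap.sub_apply, mapChain_single, Module.End.one_apply,
        map_sub, LinearMap.zero_apply, sub_eq_zero, List.map_map] at h0
      rw [← ih, ← h0]
      congr 2
      refine congrArg₂ _ (funext fun y => ?_) rfl
      simp [add_assoc]
  refine ⟨Finsupp.linearCombination K e, fun c hc => ?_, eq_of_single fun l => ?_⟩
  · refine (Submodule.mem_bot K).1 (map_mem_of_mem_supported (fun l hl => ?_) hc)
    rw [Finsupp.linearCombination_single, one_smul, Submodule.mem_bot]
    simp only [e, hd _ (single_mem_supported' hl), ite_self]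
  · simp only [LinearMap.comp_apply, LinearMap.sum_apply, mapChain_pow_single, map_sum,
      Finsupp.linearCombination_single, one_smul, iterate_add_one]
    rcases l with _ | ⟨a, l⟩
    · simp [e, hnil]
    · rw [Finset.sum_eq_single_of_mem (-a).val (Finset.mem_range.2 (ZMod.val_lt _))]
      · simp only [e]
        rw [if_pos (by simp), hinv]
      · intro i hi hia
        refine if_neg fun h => hia ?_
        have h' : a + (i : ZMod p) = 0 := by simpa using h
        rw [← eq_neg_of_add_eq_zero_right h', ZMod.val_natCast_of_lt (Finset.mem_range.1 hi)]

/-- A chain map from the resolution of a cyclic group to the chains on the group is nontrivial modulo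
degenerate chains. -/
theorem IsRes.not_degenerate [CharP K p] [Nontrivial K] {M : ℕ} {S : Set (List (ZMod p))}
    {c : ℕ → Chain K (ZMod p)}
    (h : IsRes (· + 1) p M S c) : c M ∉ degenerate K (ZMod p) := by
  suffices hk : ∀ k ≤ M, ∃ β : Chain K (ZMod p) →ₗ[K] K,
      (∀ c ∈ degenerate K (ZMod p), β c = 0) ∧
      (β ∘ₗ boundary K) ∘ₗ resElt (mapChain K (· + 1)) p k = 0 ∧ β (boundary K (c k)) = 1 by
    obtain ⟨β, hβ, -, hβ1⟩ := hk M le_rfl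
    intro hc
    rw [hβ _ (boundary_mem_degenerate hc)] at hβ1
    exact zero_ne_one hβ1
  intro k
  induction k with
  | zero =>
    intro _
    have hinv : ∀ (i : ℕ) (c : Chain K (ZMod p)),
        ((mapChain K (· + 1) : Module.End K (Chain K (ZMod p))) ^ i) c [] = c [] := by
      intro i c
      have : Finsupp.lapply [] ∘ₗ ((mapChain K (· + 1) : Module.End K (Chain K (ZMod p))) ^ i) =
          Finsupp.lapply [] := eq_of_single fun l => by
        simp [mapChain_pow_single, Finsupp.single_apply]
      exact LinearMap.congr_fun this c
    refine ⟨Finsupp.lapply [], fun c hc => ?_, LinearMap.ext fun c => ?_, ?_⟩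
    · exact Finsupp.notMem_support_iff.1 fun hm => hc hm (by simp)
    · rw [LinearMap.comp_apply, LinearMap.comp_apply, boundary_resElt]
      simp [resElt, hinv]
    · simp [h.boundary_zero]
  | succ k ih =>
    intro hk
    obtain ⟨β, hβ, hβr, hβ1⟩ := ih (by lia)
    have hd : ∀ c ∈ degenerate K (ZMod p), (β ∘ₗ boundary K) c = 0 := fun c hc =>
      hβ _ (boundary_mem_degenerate hc)
    have hnil : (β ∘ₗ boundary K) (Finsupp.single [] 1) = 0 := by simp
    obtain ⟨η, hη, hηr⟩ : ∃ η : Chain K (ZMod p) →ₗ[K] K,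
        (∀ c ∈ degenerate K (ZMod p), η c = 0) ∧
        η ∘ₗ resElt (mapChain K (· + 1)) p (k + 1) = β ∘ₗ boundary K := by
      by_cases hk : Even k
      · have hk' : ¬ Even (k + 1) := by simpa [Nat.even_add_one] using hk
        simp only [resElt, hk, hk', if_true, if_false] at hβr ⊢
        exact exists_primitive_of_norm hd hnil hβr
      · have hk' : Even (k + 1) := by simpa [Nat.even_add_one] using hk
        simp only [resElt, hk, hk', if_true, if_false] at hβr ⊢
        exact exists_primitive_of_invariant hd hnil hβr
    have hηr' : ∀ c, η (resElt (mapChain K (· + 1)) p (k + 1) c) = β (boundary K c) :=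
      fun c => LinearMap.congr_fun hηr c
    refine ⟨η, hη, LinearMap.ext fun c => ?_, ?_⟩
    · rw [LinearMap.comp_apply, LinearMap.comp_apply, boundary_resElt, hηr', boundary_boundary]
      simp
    · rw [h.boundary_succ k (by lia), hηr', hβ1]

end Cochains

section Subdivision

/-- The subdivision of a single list of length `n`, with the point `q l` playing the role of the
barycentre of `l`. -/
def subdivAux (K : Type*) [CommRing K] (q : List V → W) : ℕ → List V → Chain K W
  | 0, _ => Finsupp.single [] 1
  | n + 1, l => coneMap K (q l) (Finsupp.linearCombination K (subdivAux K q n) (boundaryList K l))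

/-- Barycentric subdivision of chains, with the point `q l` playing the role of the barycentre of
`l`. -/
def subdiv (K : Type*) [CommRing K] (q : List V → W) : Chain K V →ₗ[K] Chain K W :=
  Finsupp.linearCombination K fun l => subdivAux K q l.length l

/-- `Flag q l L` means that `L` is a simplex of full dimension in the subdivision of `l`. -/
inductive Flag (q : List V → W) : List V → List W → Prop
  | nil : Flag q [] []
  | cons {l : List V} {L : List W} {i : ℕ} (hi : i < l.length) (h : Flag q (l.eraseIdx i) L) :
      Flag q l (q l :: L)

variable {q : List V → W}

theorem subdiv_nil : subdiv K q (Finsupp.single [] 1) = Finsupp.single [] 1 := by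
  simp [subdiv, subdivAux]

theorem subdiv_single {l : List V} (hl : l ≠ []) :
    subdiv K q (Finsupp.single l 1) = coneMap K (q l) (subdiv K q (boundary K (Finsupp.single l 1))) := by
  rcases l with _ | ⟨a, l⟩
  · exact absurd rfl hl
  rw [boundary_single]
  conv_lhs => rw [subdiv, Finsupp.linearCombination_single, one_smul, List.length_cons, subdivAux]
  congr 1
  refine eq_of_mem_supported ?_ (boundaryList_mem_supported (a :: l))
  rintro _ ⟨i, hi, rfl⟩
  simp only [subdiv, Finsupp.linearCombination_single, one_smul]
  rw [List.length_eraseIdx_of_lt hi, List.length_cons, Nat.add_sub_cancel]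

/-- Induction on lists, deducing a property of a list from its faces. -/
theorem face_induction {P : List V → Prop} (hnil : P [])
    (h : ∀ l, l ≠ [] → (∀ i < l.length, P (l.eraseIdx i)) → P l) (l : List V) : P l := by
  induction hn : l.length generalizing l with
  | zero => rwa [List.length_eq_zero_iff.1 hn]
  | succ n ih =>
    refine h l (fun e => by simp [e] at hn) fun i hi => ih _ ?_
    rw [List.length_eraseIdx_of_lt hi, hn, Nat.add_sub_cancel]

theorem boundary_subdiv (c : Chain K V) :
    boundary K (subdiv K q c) = subdiv K q (boundary K c) := by
  have : boundary K ∘ₗ subdiv K q = subdiv K q ∘ₗ boundary K := eq_of_single fun l => by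
    induction l using face_induction with
    | hnil => simp [subdiv_nil]
    | h l hl ih =>
      have h1 : boundary K (subdiv K q (boundary K (Finsupp.single l 1))) =
          subdiv K q (boundary K (boundary K (Finsupp.single l 1))) := by
        rw [boundary_single]
        refine eq_of_mem_supported (F := boundary K ∘ₗ subdiv K q) (F' := subdiv K q ∘ₗ boundary K)
          ?_ (boundaryList_mem_supported l)
        rintro _ ⟨i, hi, rfl⟩
        exact ih i hi
      simp only [LinearMap.comp_apply]
      rw [subdiv_single hl, boundary_coneMap, h1, boundary_boundary]
      simp
  exact LinearMap.congr_fun this c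

theorem subdiv_mem_supported (l : List V) :
    subdiv K q (Finsupp.single l 1) ∈ Finsupp.supported K K {L | Flag q l L} := by
  induction l using face_induction with
  | hnil => rw [subdiv_nil]; exact single_mem_supported' Flag.nil
  | h l hl ih =>
    rw [subdiv_single hl]
    refine map_mem_of_mem_supported (F := coneMap K (q l))
      (S := {L | ∃ i < l.length, Flag q (l.eraseIdx i) L}) ?_ ?_
    · rintro L ⟨i, hi, hL⟩
      rw [coneMap_single]
      exact single_mem_supported' (Flag.cons hi hL)
    · rw [boundary_single]
      refine map_mem_of_mem_supported ?_ (boundaryList_mem_supported l)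
      rintro _ ⟨i, hi, rfl⟩
      refine Finsupp.supported_mono ?_ (ih i hi)
      exact fun L hL => ⟨i, hi, hL⟩

theorem subdiv_mapChain {τ : V → V} {τ' : W → W} (h : ∀ l ≠ [], q (l.map τ) = τ' (q l))
    (c : Chain K V) : subdiv K q (mapChain K τ c) = mapChain K τ' (subdiv K q c) := by
  have : subdiv K q ∘ₗ mapChain K τ = mapChain K τ' ∘ₗ subdiv K q := eq_of_single fun l => by
    induction l using face_induction with
    | hnil => simp [subdiv_nil]
    | h l hl ih =>
      have h1 : subdiv K q (mapChain K τ (boundary K (Finsupp.single l 1))) =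
          mapChain K τ' (subdiv K q (boundary K (Finsupp.single l 1))) := by
        rw [boundary_single]
        refine eq_of_mem_supported (F := subdiv K q ∘ₗ mapChain K τ)
          (F' := mapChain K τ' ∘ₗ subdiv K q) ?_ (boundaryList_mem_supported l)
        rintro _ ⟨i, hi, rfl⟩
        exact ih i hi
      simp only [LinearMap.comp_apply]
      rw [subdiv_single hl, mapChain_coneMap, mapChain_single, subdiv_single (by simpa using hl),
        h l hl, ← mapChain_single, boundary_mapChain, h1]
  exact LinearMap.congr_fun this c

namespace Flag

theorem length_eq {l : List V} {L : List W} (h : Flag q l L) : L.length = l.length := by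
  induction h with
  | nil => rfl
  | cons hi _ ih =>
    rw [List.length_cons, ih, List.length_eraseIdx_of_lt hi]
    lia

theorem exists_of_mem {l : List V} {L : List W} (h : Flag q l L) :
    ∀ x ∈ L, ∃ l', l' ≠ [] ∧ l'.Sublist l ∧ x = q l' := by
  induction h with
  | nil => simp
  | @cons l L i hi _ ih =>
    simp only [List.mem_cons, forall_eq_or_imp]
    refine ⟨⟨l, fun e => by simp [e] at hi, List.Sublist.refl l, rfl⟩, fun x hx => ?_⟩
    obtain ⟨l', h0, h1, h2⟩ := ih x hx
    exact ⟨l', h0, h1.trans (List.eraseIdx_sublist l i), h2⟩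

theorem exists_eq_cons {l : List V} {L : List W} (h : Flag q l L) (hl : l ≠ []) :
    ∃ L', L = q l :: L' := by
  cases h with
  | nil => exact absurd rfl hl
  | cons hi h => exact ⟨_, rfl⟩

/-- If `q` only depends on the set of entries of a list, then flags of a list with repetitions are
degenerate. -/
theorem not_isChain {l : List V} {L : List W} (h : Flag q l L)
    (hq : ∀ l₁ l₂, l₁.Sublist l → l₂.Sublist l₁ → l₂ ≠ [] → (∀ v ∈ l₁, v ∈ l₂) → q l₂ = q l₁)
    (hl : ¬ l.Nodup) : ¬ L.IsChain (· ≠ ·) := by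
  induction h with
  | nil => exact absurd List.nodup_nil hl
  | @cons l L i hi h ih =>
    have hsub := List.eraseIdx_sublist l i
    by_cases hl' : (l.eraseIdx i).Nodup
    · have hperm := List.getElem_cons_eraseIdx_perm hi
      have hmem : l[i] ∈ l.eraseIdx i := by
        by_contra hn
        exact hl (hperm.nodup_iff.1 (List.nodup_cons.2 ⟨hn, hl'⟩))
      have hne : l.eraseIdx i ≠ [] := List.ne_nil_of_mem hmem
      obtain ⟨L', rfl⟩ := h.exists_eq_cons hne
      have hqe := hq l _ (List.Sublist.refl l) hsub hne fun v hv => by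
        rcases List.mem_cons.1 (hperm.mem_iff.2 hv) with rfl | hv
        · exact hmem
        · exact hv
      simp [hqe]
    · exact fun hc => ih (fun l₁ l₂ h₁ h₂ => hq l₁ l₂ (h₁.trans hsub) h₂) hl' hc.tail

end Flag

/-- The barycentre of a list of points. -/
def avg {E : Type*} [AddCommGroup E] [Module ℝ E] (l : List E) : E := (l.length : ℝ)⁻¹ • l.sum

variable {E : Type*} [NormedAddCommGroup E] [NormedSpace ℝ E]

theorem avg_mem {s : Set E} (hs : Convex ℝ s) {l : List E} (hl : l ≠ []) (h : ∀ x ∈ l, x ∈ s) :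
    avg l ∈ s := by
  have hn : (l.length : ℝ) ≠ 0 := by simpa using hl
  have : avg l = ∑ i : Fin l.length, (l.length : ℝ)⁻¹ • l.get i := by
    rw [← Finset.smul_sum, avg]
    congr 1
    conv_lhs => rw [← List.ofFn_get l]
    rw [List.sum_ofFn]
  rw [this]
  refine hs.sum_mem (fun i _ => by positivity) ?_ fun i _ => h _ (List.get_mem l i)
  simp [hn]

theorem avg_map (f : E →ₗ[ℝ] E) (l : List E) : avg (l.map f) = f (avg l) := by
  simp [avg, map_list_sum]

theorem dist_avg_le {l : List E} {D : ℝ} (h : ∀ x ∈ l, ∀ y ∈ l, dist x y ≤ D) {x : E} (hx : x ∈ l) :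
    dist x (avg l) ≤ (1 - (l.length : ℝ)⁻¹) * D := by
  obtain ⟨s, t, rfl⟩ := List.append_of_mem hx
  have hperm : (s ++ x :: t).Perm (x :: (s ++ t)) := List.perm_middle
  have hD : ∀ y ∈ s ++ t, dist x y ≤ D := fun y hy =>
    h x hx y (hperm.mem_iff.2 (List.mem_cons_of_mem _ hy))
  have hlen : (s ++ x :: t).length = (s ++ t).length + 1 := by rw [hperm.length_eq, List.length_cons]
  rw [avg, hperm.sum_eq, hlen, List.sum_cons]
  generalize s ++ t = u at hD
  have hu : ‖(u.length : ℝ) • x - u.sum‖ ≤ u.length * D := by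
    clear hlen
    induction u with
    | nil => simp
    | cons y u ih =>
      have h1 := ih fun z hz => hD z (List.mem_cons_of_mem _ hz)
      have h2 := hD y List.mem_cons_self
      rw [dist_eq_norm] at h2
      calc ‖((y :: u).length : ℝ) • x - (y :: u).sum‖
          = ‖((u.length : ℝ) • x - u.sum) + (x - y)‖ := by
            congr 1
            simp only [List.length_cons, List.sum_cons]
            push_cast
            module
        _ ≤ u.length * D + D := (norm_add_le _ _).trans (add_le_add h1 h2)
        _ = _ := by simp only [List.length_cons]; push_cast; ring
  have hpos : (0 : ℝ) < (u.length : ℝ) + 1 := by positivity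
  push_cast
  have e : x - ((u.length : ℝ) + 1)⁻¹ • (x + u.sum) =
      ((u.length : ℝ) + 1)⁻¹ • ((u.length : ℝ) • x - u.sum) := by
    have : x = ((u.length : ℝ) + 1)⁻¹ • (((u.length : ℝ) + 1) • x) := by
      rw [smul_smul, inv_mul_cancel₀ hpos.ne', one_smul]
    conv_lhs => enter [1]; rw [this]
    module
  rw [dist_eq_norm, e, norm_smul, Real.norm_of_nonneg (by positivity)]
  calc ((u.length : ℝ) + 1)⁻¹ * ‖(u.length : ℝ) • x - u.sum‖
      ≤ ((u.length : ℝ) + 1)⁻¹ * (u.length * D) := by gcongr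
    _ = _ := by field_simp; ring

theorem Flag.dist_le {l L : List E} (hL : Flag avg l L) {n : ℕ} (hn : l.length ≤ n) {D : ℝ}
    (h : ∀ x ∈ l, ∀ y ∈ l, dist x y ≤ D) :
    ∀ x ∈ L, ∀ y ∈ L, dist x y ≤ (1 - (n : ℝ)⁻¹) * D := by
  induction hL with
  | nil => simp
  | @cons l L i hi hL ih =>
    have hsub := List.eraseIdx_sublist l i
    have ih' := ih (hsub.length_le.trans hn) fun x hx y hy => h x (hsub.subset hx) y (hsub.subset hy)
    have hl0 : 0 < l.length := by lia
    have hD : 0 ≤ D := by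
      have := h _ (List.getElem_mem hi) _ (List.getElem_mem hi)
      rwa [dist_self] at this
    have hθ : (1 - (l.length : ℝ)⁻¹) * D ≤ (1 - (n : ℝ)⁻¹) * D := by
      gcongr
    have h1 : ∀ y ∈ L, dist y (avg l) ≤ (1 - (n : ℝ)⁻¹) * D := by
      intro y hy
      obtain ⟨l', hl', hsub', rfl⟩ := hL.exists_of_mem y hy
      refine avg_mem (convex_closedBall (avg l) _) hl' fun x hx => ?_
      exact (dist_avg_le h ((hsub'.trans hsub).subset hx)).trans hθ
    have hn' : (0 : ℝ) ≤ (1 - (n : ℝ)⁻¹) * D := by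
      refine mul_nonneg (sub_nonneg.2 (inv_le_one_of_one_le₀ ?_)) hD
      exact_mod_cast (by lia : 1 ≤ n)
    simp only [List.mem_cons, forall_eq_or_imp, dist_self]
    refine ⟨⟨hn', fun y hy => ?_⟩, fun x hx => ⟨h1 x hx, ih' x hx⟩⟩
    rw [dist_comm]
    exact h1 y hy

end Subdivision

section Colour

variable {C : Type*} [LinearOrder C] {p : ℕ}

/-- The second component of the first entry with minimal first component. -/
def lead (l : List (C × ZMod p)) : ZMod p := ((l.argmin Prod.fst).map Prod.snd).getD 0

theorem argmin_map_add (l : List (C × ZMod p)) :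
    (l.map fun v => (v.1, v.2 + 1)).argmin Prod.fst =
      (l.argmin Prod.fst).map fun v => (v.1, v.2 + 1) := by
  induction l with
  | nil => rfl
  | cons v l ih =>
    rw [List.map_cons, List.argmin_cons, List.argmin_cons, ih]
    rcases l.argmin Prod.fst with _ | w
    · rfl
    · simp only [Option.map_some]
      split_ifs <;> rfl

theorem lead_map {l : List (C × ZMod p)} (hl : l ≠ []) :
    lead (l.map fun v => (v.1, v.2 + 1)) = lead l + 1 := by
  obtain ⟨v, hv⟩ : ∃ v, l.argmin Prod.fst = some v :=
    Option.ne_none_iff_exists'.1 fun h => hl (List.argmin_eq_none.1 h)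
  simp [lead, argmin_map_add, hv]

theorem lead_eq_lead {l l' : List (C × ZMod p)} (hl : ∀ v ∈ l, ∀ w ∈ l, v.1 = w.1 → v.2 = w.2)
    (hsub : ∀ v ∈ l', v ∈ l) (hl' : l' ≠ []) (h : ∀ v ∈ l, v ∈ l') : lead l' = lead l := by
  have hne : l ≠ [] := fun e => by
    obtain ⟨v, hv⟩ := List.exists_mem_of_ne_nil l' hl'
    simpa [e] using hsub v hv
  obtain ⟨v, hv⟩ : ∃ v, l.argmin Prod.fst = some v :=
    Option.ne_none_iff_exists'.1 fun h => hne (List.argmin_eq_none.1 h)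
  obtain ⟨w, hw⟩ : ∃ w, l'.argmin Prod.fst = some w :=
    Option.ne_none_iff_exists'.1 fun h => hl' (List.argmin_eq_none.1 h)
  have hvl := List.argmin_mem hv
  have hwl := hsub w (List.argmin_mem hw)
  have h1 : v.1 ≤ w.1 := List.le_of_mem_argmin hwl hv
  have h2 : w.1 ≤ v.1 := List.le_of_mem_argmin (h v hvl) hw
  simp [lead, hv, hw, hl w hwl v hvl (h2.antisymm h1)]

/-- The combinatorial core: chains on lists of entries whose colour, out of `M` colours, determines
their group component do not carry a resolution sequence up to degree `M`. -/
theorem IsRes.false_of_coloured [NeZero p] [CharP K p] [Nontrivial K] [Fintype C] {M : ℕ}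
    (hC : Fintype.card C = M) {c : ℕ → Chain K (C × ZMod p)}
    (h : IsRes (fun v => (v.1, v.2 + 1)) p M
      {l | ∀ v ∈ l, ∀ w ∈ l, v.1 = w.1 → v.2 = w.2} c) : False := by
  have hres : IsRes (· + 1) p M {L | L.length = M + 1 → ¬ L.IsChain (· ≠ ·)}
      (fun k => subdiv K lead (c k)) := by
    refine h.map subdiv_nil boundary_subdiv ?_ (fun l _ => ?_) fun l hl _ => ?_
    · intro l hl v hv w hw hvw
      obtain ⟨v, hv', rfl⟩ := List.mem_map.1 hv
      obtain ⟨w, hw', rfl⟩ := List.mem_map.1 hw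
      simp only [hl v hv' w hw' hvw]
    · rw [← mapChain_single, subdiv_mapChain (τ' := (· + 1)) fun l hl => lead_map hl]
    · refine Finsupp.supported_mono ?_ (subdiv_mem_supported l)
      intro L hL
      refine ⟨hL.length_eq, fun hlen => ?_⟩
      refine hL.not_isChain (fun l₁ l₂ h₁ h₂ hne hmem => ?_) fun hnd => ?_
      · exact lead_eq_lead (fun v hv w hw => hl v (h₁.subset hv) w (h₁.subset hw))
          (fun v hv => h₂.subset hv) hne hmem
      · have hnd' : (l.map Prod.fst).Nodup := hnd.map_on fun v hv w hw hvw =>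
          Prod.ext hvw (hl v hv w hw hvw)
        have := hnd'.length_le_card
        rw [List.length_map, ← hL.length_eq, hlen, hC] at this
        lia
  refine hres.not_degenerate (Finsupp.supported_mono ?_ (hres.mem M le_rfl))
  exact fun L hL => hL.2 hL.1

end Colour

section Fine

variable {G : Type*} [Group G] [Fintype G]

omit [Group G] in
theorem joinFace_mem_Icc {m j : ℕ} {a : Fin m → G} {x : Fin m × G → ℝ} (hx : x ∈ joinFace a j) :
    x ∈ Icc 0 1 :=
  ⟨hx.1, fun v => by
    rw [Pi.one_apply, ← hx.2.1]
    exact Finset.single_le_sum (fun w _ => hx.1 w) (Finset.mem_univ v)⟩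

theorem dist_shift_le {m : ℕ} (g : G) (x y : Fin m × G → ℝ) :
    dist (shift g x) (shift g y) ≤ dist x y :=
  (dist_pi_le_iff dist_nonneg).2 fun v => dist_le_pi_dist x y (v.1, g⁻¹ * v.2)

theorem isCompact_join (m j : ℕ) : IsCompact (join m G j) :=
  isCompact_Icc.of_isClosed_subset (isClosed_join j)
    (iUnion_subset fun _ _ hx => joinFace_mem_Icc hx)

/-- The resolution of a cyclic group maps to arbitrarily fine chains on the join. -/
theorem exists_isRes_join (K : Type*) [CommRing K] (g : G) {p : ℕ} (hg : g ^ p = 1) (M : ℕ) {ε : ℝ}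
    (hε : 0 < ε) :
    ∃ c : ℕ → Chain K (Fin (M + 1) × G → ℝ), IsRes (shift g) p M
      {l | (∃ a, ∀ x ∈ l, x ∈ joinFace a (M + 1)) ∧ ∀ x ∈ l, ∀ y ∈ l, dist x y < ε} c := by
  classical
  set θ : ℝ := 1 - ((M + 1 : ℕ) : ℝ)⁻¹ with hθ
  have hθ0 : 0 ≤ θ := sub_nonneg.2 (inv_le_one_of_one_le₀ (by norm_cast; lia))
  have hθ1 : θ < 1 := sub_lt_self 1 (by positivity)
  have key : ∀ r : ℕ, ∃ c : ℕ → Chain K (Fin (M + 1) × G → ℝ), IsRes (shift g) p M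
      {l | (∃ a, ∀ x ∈ l, x ∈ joinFace a (M + 1)) ∧ ∀ x ∈ l, ∀ y ∈ l, dist x y ≤ θ ^ r} c := by
    intro r
    induction r with
    | zero =>
      let e : ℕ × G → Fin (M + 1) × G → ℝ := fun v => Pi.single (Fin.ofNat (M + 1) v.1, v.2) 1
      refine ⟨_, (isRes_standardRes (K := K) g hg M).map (F := mapChain K e) (by simp)
        (boundary_mapChain e) ?_ (fun l _ => ?_) ?_⟩
      · rintro l ⟨hl, a, ha⟩
        refine ⟨?_, fun i => g * a i, ?_⟩
        · intro w hw
          obtain ⟨v, hv, rfl⟩ := List.mem_map.1 hw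
          exact hl v hv
        · intro w hw
          obtain ⟨v, hv, rfl⟩ := List.mem_map.1 hw
          simp only [ha v hv]
      · simp only [mapChain_single, List.map_map]
        congr 2
        ext1 v
        simp only [Function.comp_apply, e, shift_single]
      · rintro l ⟨hl, a, ha⟩ -
        rw [mapChain_single]
        have hface : ∀ x ∈ l.map e, x ∈ joinFace (fun i : Fin (M + 1) => a i) (M + 1) := by
          intro x hx
          obtain ⟨v, hv, rfl⟩ := List.mem_map.1 hx
          refine ⟨fun w => ?_, by simp [e], fun w hw => ?_⟩
          · simp only [e, Pi.single_apply]
            split_ifs <;> simp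
          · have hw' : w = (Fin.ofNat (M + 1) v.1, v.2) := by
              by_contra hne
              exact hw (Pi.single_eq_of_ne hne _)
            rw [hw']
            refine ⟨?_, Fin.is_lt _⟩
            simp only [ha v hv, Fin.val_ofNat]
            rw [Nat.mod_eq_of_lt (Nat.lt_succ_of_le (hl v hv))]
        refine single_mem_supported' ⟨by simp, ⟨_, hface⟩, fun x hx y hy => ?_⟩
        rw [pow_zero]
        have hx' := joinFace_mem_Icc (hface x hx)
        have hy' := joinFace_mem_Icc (hface y hy)
        refine (dist_pi_le_iff zero_le_one).2 fun v => ?_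
        have := hx'.1 v
        have := hx'.2 v
        have := hy'.1 v
        have := hy'.2 v
        simp only [Pi.zero_apply, Pi.one_apply] at *
        rw [Real.dist_eq, abs_le]
        constructor <;> linarith
    | succ r ih =>
      obtain ⟨c, hc⟩ := ih
      refine ⟨_, hc.map (F := subdiv K avg) subdiv_nil boundary_subdiv ?_ (fun l _ => ?_) ?_⟩
      · rintro l ⟨⟨a, ha⟩, hl⟩
        refine ⟨⟨fun i => g * a i, ?_⟩, ?_⟩
        · intro y hy
          obtain ⟨x, hx, rfl⟩ := List.mem_map.1 hy
          exact shift_mem_joinFace g (ha x hx)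
        · intro x hx y hy
          obtain ⟨x, hx', rfl⟩ := List.mem_map.1 hx
          obtain ⟨y, hy', rfl⟩ := List.mem_map.1 hy
          exact (dist_shift_le g x y).trans (hl x hx' y hy')
      · rw [← mapChain_single, subdiv_mapChain fun l _ => avg_map (shift g) l]
      · rintro l ⟨⟨a, ha⟩, hl⟩ hlen
        refine Finsupp.supported_mono ?_ (subdiv_mem_supported l)
        intro L hL
        refine ⟨hL.length_eq, ⟨a, fun x hx => ?_⟩, ?_⟩
        · obtain ⟨l', hl', hsub, rfl⟩ := hL.exists_of_mem x hx
          exact avg_mem (convex_joinFace a _) hl' fun x hx => ha x (hsub.subset hx)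
        · rw [pow_succ']
          exact hL.dist_le hlen hl
  obtain ⟨r, hr⟩ := exists_pow_lt_of_lt_one hε hθ1
  obtain ⟨c, hc⟩ := key r
  refine ⟨c, fun k hk => Finsupp.supported_mono ?_ (hc.mem k hk), hc.boundary_zero,
    hc.boundary_succ⟩
  exact fun l hl => ⟨hl.1, hl.2.1, fun x hx y hy => (hl.2.2 x hx y hy).trans_lt hr⟩

end Fine

/-- Dold's theorem for cyclic groups. -/
theorem le_of_equivariant_of_isCyclic {G : Type*} [Group G] [Finite G] [Nontrivial G] [IsCyclic G]
    {n N : ℕ} [MulAction G (Sph n)] [ContinuousConstSMul G (Sph n)] [MulAction G (Sph N)]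
    [ContinuousConstSMul G (Sph N)] (hfree : ∀ g : G, g ≠ 1 → ∀ y : Sph N, g • y ≠ y)
    {f : Sph n → Sph N} (hf : Continuous f) (hfe : ∀ (g : G) x, f (g • x) = g • f x) : n ≤ N := by
  by_contra! hlt
  have := Fintype.ofFinite G
  obtain ⟨c, γ, δ, hδ, hc, hγ, hcγ⟩ := exists_labelling_sphere N hfree
  obtain ⟨Φ, hΦ, hΦe⟩ := exists_equivariant_of_join (G := G) (m := N + 1 + 1) n le_rfl
    (show N + 1 + 1 ≤ n + 1 by lia)
  set p := Nat.card G with hp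
  have hp1 : 1 < p := Finite.one_lt_card
  have : NeZero p := ⟨by lia⟩
  have : Fact (1 < p) := ⟨hp1⟩
  let e : Multiplicative (ZMod p) ≃* G := zmodCyclicMulEquiv inferInstance
  let g : G := e (Multiplicative.ofAdd 1)
  let ι : G → ZMod p := fun h => Multiplicative.toAdd (e.symm h)
  have hι : ∀ h, ι (g * h) = ι h + 1 := fun h => by
    simp [ι, g, add_comm]
  have hιi : Function.Injective ι := fun h k hhk => e.symm.injective hhk
  have hg : g ^ p = 1 := by rw [hp]; exact pow_card_eq_one'
  obtain ⟨ε, hε, hu⟩ := Metric.uniformContinuousOn_iff.1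
    ((isCompact_join (G := G) (N + 1 + 1) (N + 1 + 1)).uniformContinuousOn_of_continuous
      (hf.comp_continuousOn hΦ)) δ hδ
  obtain ⟨d, hd⟩ := exists_isRes_join (ZMod p) g hg (N + 1) hε
  let label : (Fin (N + 1 + 1) × G → ℝ) → Fin (N + 1) × ZMod p := fun x =>
    (c (f (Φ x)), ι (γ (f (Φ x))))
  have hmem : ∀ {a : Fin (N + 1 + 1) → G} {x}, x ∈ joinFace a (N + 1 + 1) →
      x ∈ join (N + 1 + 1) G (N + 1 + 1) := fun hx => mem_iUnion.2 ⟨_, hx⟩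
  refine (hd.map (F := mapChain (ZMod p) label) (τ' := fun v => (v.1, v.2 + 1)) (by simp)
    (boundary_mapChain label) ?_ ?_ ?_).false_of_coloured (Fintype.card_fin _)
  · rintro l ⟨⟨a, ha⟩, hl⟩
    refine ⟨⟨fun i => g * a i, ?_⟩, ?_⟩
    · intro y hy
      obtain ⟨x, hx, rfl⟩ := List.mem_map.1 hy
      exact shift_mem_joinFace g (ha x hx)
    · intro x hx y hy
      obtain ⟨x, hx', rfl⟩ := List.mem_map.1 hx
      obtain ⟨y, hy', rfl⟩ := List.mem_map.1 hy
      exact (dist_shift_le g x y).trans_lt (hl x hx' y hy')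
  · rintro l ⟨⟨a, ha⟩, -⟩
    simp only [mapChain_single, List.map_map]
    congr 1
    refine List.map_congr_left fun x hx => ?_
    simp only [label, Function.comp_apply, hΦe g x (hmem (ha x hx)), hfe, hc, hγ, hι]
  · rintro l ⟨⟨a, ha⟩, hl⟩ -
    rw [mapChain_single]
    refine single_mem_supported' ⟨by simp, ?_⟩
    intro v hv w hw hvw
    obtain ⟨x, hx, rfl⟩ := List.mem_map.1 hv
    obtain ⟨y, hy, rfl⟩ := List.mem_map.1 hw
    exact congrArg ι (hcγ _ _ (hu x (hmem (ha x hx)) y (hmem (ha y hy)) (hl x hx y hy)) hvw)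

end Chains

end Dold

/-- **Dold's theorem on equivariant maps of spheres**: if a nontrivial finite group `G` acts
continuously and freely on `S^n` and on `S^N`, and there exists a continuous `G`-equivariant
map `f : S^n → S^N`, then `n ≤ N`. -/
theorem dold_equivariant_spheres (n N : ℕ)
    (G : Type*) [Group G] [Finite G] [Nontrivial G] [TopologicalSpace G]
    [MulAction G (Metric.sphere (0 : EuclideanSpace ℝ (Fin (n + 1))) 1)]
    [ContinuousSMul G (Metric.sphere (0 : EuclideanSpace ℝ (Fin (n + 1))) 1)]
    [MulAction G (Metric.sphere (0 : EuclideanSpace ℝ (Fin (N + 1))) 1)]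
    [ContinuousSMul G (Metric.sphere (0 : EuclideanSpace ℝ (Fin (N + 1))) 1)]
    (hfree_n : ∀ g : G, g ≠ 1 →
      ∀ x : (Metric.sphere (0 : EuclideanSpace ℝ (Fin (n + 1))) 1), g • x ≠ x)
    (hfree_N : ∀ g : G, g ≠ 1 →
      ∀ y : (Metric.sphere (0 : EuclideanSpace ℝ (Fin (N + 1))) 1), g • y ≠ y)
    (f : (Metric.sphere (0 : EuclideanSpace ℝ (Fin (n + 1))) 1) →
      (Metric.sphere (0 : EuclideanSpace ℝ (Fin (N + 1))) 1))
    (hf : Continuous f)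
    (hequiv : ∀ (g : G) (x : (Metric.sphere (0 : EuclideanSpace ℝ (Fin (n + 1))) 1)),
      f (g • x) = g • f x) :
    n ≤ N := by
  obtain ⟨g, hg⟩ := exists_ne (1 : G)
  have : Nontrivial (Subgroup.zpowers g) :=
    (Subgroup.nontrivial_iff_ne_bot _).2 (by simpa using hg)
  have hn : ContinuousConstSMul (Subgroup.zpowers g)
      (Metric.sphere (0 : EuclideanSpace ℝ (Fin (n + 1))) 1) :=
    ⟨fun h => continuous_const_smul (h : G)⟩
  have hN : ContinuousConstSMul (Subgroup.zpowers g)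
      (Metric.sphere (0 : EuclideanSpace ℝ (Fin (N + 1))) 1) :=
    ⟨fun h => continuous_const_smul (h : G)⟩
  exact Dold.le_of_equivariant_of_isCyclic (G := Subgroup.zpowers g)
    (fun h hh y => hfree_N h (by simpa using hh) y) hf fun h x => hequiv h x
end
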